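/- arXiv:1602.02480 — 2 statements merged into one kernel-verified Lean document; each statement's English description precedes it below -/
import Mathlib

section
/- Let α ∈ (0,1). Let S and S' be independent random variables each having the same positive strictly stable distribution with exponent α. Then the ratio S/S' has an absolutely continuous distribution on (0,∞) whose probability density is p_α(x) = sin(πα)·x^{α-1} / (π·(1 + x^{2α} + 2·x^{α}·cos(πα))) for x > 0. -/
open MeasureTheory ProbabilityTheory Filter Set
open scoped Topology ENNReal

lemma integrable_exp_neg_aux {Ω : Type*} [MeasurableSpace Ω] (P : Measure Ω) [IsProbabilityMeasure P]
    (S : Ω → ℝ) (hSm : Measurable S) (hSnn : ∀ᵐ ω ∂P, 0 ≤ S ω) (s : ℝ) (hs : 0 ≤ s) :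
    Integrable (fun ω => Real.exp (-(s * S ω))) P := by
  refine Integrable.of_bound (C := 1) (by fun_prop) ?_
  filter_upwards [hSnn] with ω h
  rw [Real.norm_eq_abs, Real.abs_exp, Real.exp_le_one_iff]
  have := mul_nonneg hs h
  linarith

lemma stable_pos {Ω : Type*} [MeasurableSpace Ω] (P : Measure Ω) [IsProbabilityMeasure P]
    (α : ℝ) (hα0 : 0 < α)
    (S : Ω → ℝ) (hSm : Measurable S) (hSnn : ∀ᵐ ω ∂P, 0 ≤ S ω)
    (hS : ∀ s : ℝ, 0 ≤ s →
      ∫ ω, Real.exp (-(s * S ω)) ∂P = Real.exp (-(s ^ α))) : ∀ᵐ ω ∂P, 0 < S ω := by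
  have hmeas : MeasurableSet {ω | S ω = 0} := hSm (measurableSet_singleton 0)
  have h1 : ∀ s : ℝ, 0 ≤ s → P.real {ω | S ω = 0} ≤ Real.exp (-(s ^ α)) := by
    intro s hs
    rw [← hS s hs, ← integral_indicator_one hmeas]
    apply integral_mono ((integrable_const (1:ℝ)).indicator hmeas)
      (integrable_exp_neg_aux P S hSm hSnn s hs)
    intro ω
    by_cases h : S ω = 0
    · simp [h]
    · simp [h]; positivity
  have h2 : Tendsto (fun s : ℝ => Real.exp (-(s ^ α))) atTop (𝓝 0) :=
    Real.tendsto_exp_neg_atTop_nhds_zero.comp (tendsto_rpow_atTop hα0)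
  have h3 : P.real {ω | S ω = 0} ≤ 0 :=
    ge_of_tendsto h2 ((eventually_ge_atTop 0).mono h1)
  have h4 : P {ω | S ω = 0} = 0 := by
    have := le_antisymm h3 measureReal_nonneg
    rwa [measureReal_eq_zero_iff] at this
  have h5 : ∀ᵐ ω ∂P, S ω ≠ 0 := by
    rw [ae_iff]; simpa using h4
  filter_upwards [hSnn, h5] with ω a b
  exact lt_of_le_of_ne a b.symm

lemma stable_deriv {Ω : Type*} [MeasurableSpace Ω] (P : Measure Ω) [IsProbabilityMeasure P]
    (α : ℝ)
    (S : Ω → ℝ) (hSm : Measurable S) (hSnn : ∀ᵐ ω ∂P, 0 ≤ S ω)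
    (hS : ∀ s : ℝ, 0 ≤ s →
      ∫ ω, Real.exp (-(s * S ω)) ∂P = Real.exp (-(s ^ α))) (u : ℝ) (hu : 0 < u) :
    Integrable (fun ω => S ω * Real.exp (-(u * S ω))) P ∧
    ∫ ω, S ω * Real.exp (-(u * S ω)) ∂P = α * u ^ (α - 1) * Real.exp (-(u ^ α)) := by
  have hmem : -u ∈ interior (integrableExpSet S P) := by
    apply interior_maximal (s := integrableExpSet S P) (t := Iio 0) _ isOpen_Iio
    · simpa using hu
    · intro t ht
      have := integrable_exp_neg_aux P S hSm hSnn (-t) (by simp at ht; linarith)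
      simpa [integrableExpSet] using this
  constructor
  · have := integrable_pow_mul_exp_of_mem_interior_integrableExpSet hmem 1
    simpa using this
  · have h1 := hasDerivAt_mgf hmem
    have h2 : HasDerivAt (fun t : ℝ => Real.exp (-((-t) ^ α)))
        (α * u ^ (α - 1) * Real.exp (-(u ^ α))) (-u) := by
      have h3 : HasDerivAt (fun t : ℝ => (-t) ^ α) (-1 * α * (- -u) ^ (α - 1)) (-u) :=
        (hasDerivAt_neg (-u)).rpow_const (Or.inl (by simpa using hu.ne'))
      convert h3.fun_neg.exp using 1
      simp only [neg_neg]; ring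
    have h4 : mgf S P =ᶠ[𝓝 (-u)] (fun t : ℝ => Real.exp (-((-t) ^ α))) := by
      filter_upwards [isOpen_Iio.mem_nhds (show -u ∈ Iio (0:ℝ) by simpa using hu)] with t ht
      rw [← hS (-t) (by simp at ht; linarith)]
      simp [mgf]
    have h5 := (h2.congr_of_eventuallyEq h4).unique h1
    rw [h5]; simp

lemma exp_lintegral (c : ℝ) (hc : 0 < c) (a : ℝ) (ha : 0 ≤ a) :
    ∫⁻ t in Ioi (0:ℝ), ENNReal.ofReal (a * Real.exp (-(t * c))) = ENNReal.ofReal (a / c) := by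
  have hi : IntegrableOn (fun t : ℝ => Real.exp (-(t * c))) (Ioi 0) := by
    have := integrableOn_exp_mul_Ioi (a := -c) (by linarith) 0
    refine this.congr_fun (fun t _ => ?_) measurableSet_Ioi
    simp [mul_comm]
  rw [← ofReal_integral_eq_lintegral_ofReal (hi.const_mul a)
    (Eventually.of_forall fun t => by positivity), integral_const_mul]
  have := integral_exp_mul_Ioi (a := -c) (by linarith) 0
  have h2 : ∫ t in Ioi (0:ℝ), Real.exp (-(t * c)) = 1 / c := by
    have h3 : -Real.exp (-c * 0) / -c = 1 / c := by simp
    rw [← h3, ← this]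
    congr 1; ext t; congr 1; ring
  rw [h2]; congr 1; ring

lemma stieltjes_real {Ω : Type*} [MeasurableSpace Ω] (P : Measure Ω) [IsProbabilityMeasure P]
    (α : ℝ) (hα0 : 0 < α)
    (S S' : Ω → ℝ) (hSm : Measurable S) (hS'm : Measurable S')
    (hSnn : ∀ᵐ ω ∂P, 0 ≤ S ω) (hS'nn : ∀ᵐ ω ∂P, 0 ≤ S' ω)
    (hS : ∀ s : ℝ, 0 ≤ s →
      ∫ ω, Real.exp (-(s * S ω)) ∂P = Real.exp (-(s ^ α)))
    (hS' : ∀ s : ℝ, 0 ≤ s →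
      ∫ ω, Real.exp (-(s * S' ω)) ∂P = Real.exp (-(s ^ α)))
    (hindep : IndepFun S S' P) (z : ℝ) (hz : 0 < z) :
    ∫ ω, (z + S ω / S' ω)⁻¹ ∂P = z ^ (α - 1) / (1 + z ^ α) := by
  have hp := stable_pos P α hα0 S hSm hSnn hS
  have hp' := stable_pos P α hα0 S' hS'm hS'nn hS'
  have hzα : 0 < z ^ α := Real.rpow_pos_of_pos hz α
  have hzα1 : 0 < z ^ (α - 1) := Real.rpow_pos_of_pos hz _
  have key : ∫⁻ ω, ENNReal.ofReal ((z + S ω / S' ω)⁻¹) ∂P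
      = ENNReal.ofReal (z ^ (α - 1) / (1 + z ^ α)) := by
    calc ∫⁻ ω, ENNReal.ofReal ((z + S ω / S' ω)⁻¹) ∂P
        = ∫⁻ ω, (∫⁻ t in Ioi (0:ℝ),
            ENNReal.ofReal (S' ω * Real.exp (-(t * (z * S' ω + S ω))))) ∂P := by
          apply lintegral_congr_ae
          filter_upwards [hp, hp'] with ω h h'
          rw [exp_lintegral _ (by positivity) _ h'.le]
          congr 1; field_simp
      _ = ∫⁻ t in Ioi (0:ℝ), ∫⁻ ω,
            ENNReal.ofReal (S' ω * Real.exp (-(t * (z * S' ω + S ω)))) ∂P := by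
          apply lintegral_lintegral_swap
          unfold Function.uncurry
          apply Measurable.aemeasurable
          fun_prop
      _ = ∫⁻ t in Ioi (0:ℝ), ENNReal.ofReal
            (α * z ^ (α - 1) * (t ^ (α - 1) * Real.exp (-(1 + z ^ α) * t ^ α))) := by
          apply setLIntegral_congr_fun measurableSet_Ioi
          intro t ht
          have ht : 0 < t := ht
          have htz : 0 < t * z := by positivity
          obtain ⟨hi, he⟩ := stable_deriv P α S' hS'm hS'nn hS' (t * z) htz
          have hi2 := integrable_exp_neg_aux P S hSm hSnn t ht.le
          have hind : IndepFun (fun ω => S' ω * Real.exp (-(t * z * S' ω)))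
              (fun ω => Real.exp (-(t * S ω))) P :=
            hindep.symm.comp (φ := fun x => x * Real.exp (-(t * z * x)))
              (ψ := fun x => Real.exp (-(t * x))) (by fun_prop) (by fun_prop)
          have heq : ∀ ω, S' ω * Real.exp (-(t * (z * S' ω + S ω)))
              = S' ω * Real.exp (-(t * z * S' ω)) * Real.exp (-(t * S ω)) := by
            intro ω
            rw [mul_assoc, ← Real.exp_add]; congr 2; ring
          simp_rw [heq]
          have hi3 : Integrable (fun ω => S' ω * Real.exp (-(t * z * S' ω))
              * Real.exp (-(t * S ω))) P := hind.integrable_mul hi hi2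
          rw [← ofReal_integral_eq_lintegral_ofReal hi3
            (by filter_upwards [hp'] with ω h; simp only [Pi.zero_apply]; positivity)]
          rw [hind.integral_fun_mul_eq_mul_integral hi.1 hi2.1, he, hS t ht.le,
            Real.mul_rpow ht.le hz.le, Real.mul_rpow ht.le hz.le]
          congr 1
          rw [mul_assoc _ (Real.exp _), ← Real.exp_add]
          rw [show -(t ^ α * z ^ α) + -t ^ α = -(1 + z ^ α) * t ^ α by ring]
          ring
      _ = ENNReal.ofReal (z ^ (α - 1) / (1 + z ^ α)) := by
          have hI := integral_rpow_mul_exp_neg_mul_rpow (p := α) (q := α - 1) (b := 1 + z ^ α)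
            hα0 (by linarith) (by positivity)
          have hval : (∫ t in Ioi (0:ℝ), t ^ (α - 1) * Real.exp (-(1 + z ^ α) * t ^ α))
              = (1 + z ^ α)⁻¹ * (1 / α) := by
            rw [hI]; 
            rw [show α - 1 + 1 = α by ring, neg_div, div_self hα0.ne', Real.Gamma_one,
              Real.rpow_neg_one, mul_one]
          have hint : IntegrableOn
              (fun t : ℝ => t ^ (α - 1) * Real.exp (-(1 + z ^ α) * t ^ α)) (Ioi 0) := by
            apply Integrable.of_integral_ne_zero
            rw [hval]; positivity
          rw [← ofReal_integral_eq_lintegral_ofReal (hint.const_mul _), integral_const_mul, hval]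
          · congr 1; field_simp
          · rw [EventuallyLE, ae_restrict_iff' measurableSet_Ioi]
            refine Eventually.of_forall fun t ht => ?_
            have ht : 0 < t := ht
            simp only [Pi.zero_apply]
            positivity
  rw [integral_eq_lintegral_of_nonneg_ae, key, ENNReal.toReal_ofReal (by positivity)]
  · filter_upwards [hp, hp'] with ω h h'
    simp only [Pi.zero_apply]
    positivity
  · apply Measurable.aestronglyMeasurable; fun_prop

lemma norm_add_ge (z : ℂ) (δ : ℝ) (h : Metric.ball z δ ⊆ Complex.slitPlane) (r : ℝ) (hr : 0 ≤ r) :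
    δ ≤ ‖z + r‖ := by
  by_contra! hlt
  have : (-(r:ℂ)) ∈ Metric.ball z δ := by
    rw [Metric.mem_ball, dist_comm, dist_eq_norm]; simpa using hlt
  have h2 := h this
  rw [← Complex.ofReal_neg, Complex.ofReal_mem_slitPlane] at h2
  linarith

lemma one_add_cpow_ne (α : ℝ) (hα0 : 0 < α) (hα1 : α < 1) (z : ℂ) (hz : z ≠ 0) :
    1 + z ^ (α : ℂ) ≠ 0 := by
  intro h
  have h1 : z ^ (α : ℂ) = -1 := by linear_combination h
  rw [Complex.cpow_def_of_ne_zero hz] at h1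
  have him : (Complex.log z * α).im = α * z.arg := by
    simp [mul_comm, Complex.log_im]
  have hpi := Real.pi_pos
  have h2 := Complex.log_exp (x := Complex.log z * α)
    (by rw [him]; nlinarith [Complex.neg_pi_lt_arg z, Complex.arg_le_pi z])
    (by rw [him]; nlinarith [Complex.neg_pi_lt_arg z, Complex.arg_le_pi z])
  rw [h1, Complex.log_neg_one] at h2
  have h3 := congrArg Complex.im h2
  rw [him] at h3
  simp at h3
  nlinarith [Complex.neg_pi_lt_arg z, Complex.arg_le_pi z]

lemma stieltjes_diff (ν : Measure ℝ) [IsProbabilityMeasure ν] (h0 : ∀ᵐ r ∂ν, 0 < r) :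
    DifferentiableOn ℂ (fun z : ℂ => ∫ r, (z + (r:ℂ))⁻¹ ∂ν) Complex.slitPlane := by
  intro z₀ hz₀
  obtain ⟨δ, hδ, hb⟩ := Metric.isOpen_iff.1 Complex.isOpen_slitPlane z₀ hz₀
  have hlow : ∀ r : ℝ, 0 ≤ r → ∀ z ∈ Metric.ball z₀ (δ/2), δ / 2 ≤ ‖z + r‖ := by
    intro r hr z hz
    apply norm_add_ge z (δ/2) _ r hr
    refine subset_trans ?_ hb
    apply Metric.ball_subset_ball'
    rw [Metric.mem_ball] at hz; linarith
  have hm : ∀ z : ℂ, Measurable (fun r : ℝ => (z + (r:ℂ))⁻¹) := fun z => by fun_prop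
  have := hasDerivAt_integral_of_dominated_loc_of_deriv_le (μ := ν) (𝕜 := ℂ)
    (F := fun (z : ℂ) (r : ℝ) => (z + (r:ℂ))⁻¹)
    (F' := fun z r => -1 / (z + (r:ℂ)) ^ 2) (x₀ := z₀) (s := Metric.ball z₀ (δ/2))
    (bound := fun _ => 1 / (δ/2)^2)
    (Metric.ball_mem_nhds _ (by positivity))
    (Eventually.of_forall fun z => (hm z).aestronglyMeasurable)
    (Integrable.of_bound (C := (δ/2)⁻¹) (hm z₀).aestronglyMeasurable (by
      filter_upwards [h0] with r hr
      rw [norm_inv]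
      exact inv_anti₀ (by positivity) (hlow r hr.le z₀ (Metric.mem_ball_self (by positivity)))))
    (by apply Measurable.aestronglyMeasurable; fun_prop)
    (by
      filter_upwards [h0] with r hr z hz
      rw [norm_div, norm_neg, norm_one, norm_pow]
      have := hlow r hr.le z hz
      gcongr)
    (integrable_const _)
    (by
      filter_upwards [h0] with r hr z hz
      have hne : z + (r:ℂ) ≠ 0 := by
        rw [← norm_pos_iff]
        have := hlow r hr.le z hz
        linarith
      exact ((hasDerivAt_id z).add_const (r:ℂ)).fun_inv hne)
  exact this.2.differentiableAt.differentiableWithinAt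

lemma stieltjes_complex (ν : Measure ℝ) [IsProbabilityMeasure ν] (h0 : ∀ᵐ r ∂ν, 0 < r)
    (α : ℝ) (hα0 : 0 < α) (hα1 : α < 1)
    (hreal : ∀ z : ℝ, 0 < z → ∫ r, (z + r)⁻¹ ∂ν = z ^ (α - 1) / (1 + z ^ α))
    (z : ℂ) (hz : z ∈ Complex.slitPlane) :
    ∫ r, (z + (r:ℂ))⁻¹ ∂ν = z ^ ((α:ℂ) - 1) / (1 + z ^ (α:ℂ)) := by
  have hd := (stieltjes_diff ν h0).analyticOnNhd Complex.isOpen_slitPlane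
  have hd2 : DifferentiableOn ℂ (fun z : ℂ => z ^ ((α:ℂ) - 1) / (1 + z ^ (α:ℂ)))
      Complex.slitPlane := by
    intro w hw
    apply DifferentiableAt.differentiableWithinAt
    have h1 : DifferentiableAt ℂ (fun z : ℂ => z ^ ((α:ℂ) - 1)) w :=
      differentiableAt_id.cpow_const hw
    have h2 : DifferentiableAt ℂ (fun z : ℂ => z ^ (α:ℂ)) w :=
      differentiableAt_id.cpow_const hw
    exact h1.div (h2.const_add 1)
      (one_add_cpow_ne α hα0 hα1 w (Complex.slitPlane_ne_zero hw))
  have hd3 := hd2.analyticOnNhd Complex.isOpen_slitPlane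
  have hpre : IsPreconnected Complex.slitPlane :=
    (Complex.starConvex_one_slitPlane.isPathConnected
      Complex.one_mem_slitPlane).isConnected.isPreconnected
  refine hd.eqOn_of_preconnected_of_frequently_eq hd3 hpre (z₀ := 1)
    Complex.one_mem_slitPlane ?_ hz
  have hfr : ∃ᶠ (x : ℝ) in 𝓝[≠] 1, (0:ℝ) < x := by
    apply Eventually.frequently
    exact eventually_nhdsWithin_of_eventually_nhds (lt_mem_nhds one_pos)
  have ht : Tendsto (fun x : ℝ => (x : ℂ)) (𝓝[≠] 1) (𝓝[≠] 1) := by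
    apply tendsto_nhdsWithin_of_tendsto_nhds_of_eventually_within
    · exact (Complex.continuous_ofReal.tendsto' 1 1 (by simp)).mono_left nhdsWithin_le_nhds
    · filter_upwards [self_mem_nhdsWithin] with x hx
      simpa using hx
  refine ht.frequently (hfr.mono fun x hx => ?_)
  have := hreal x hx
  have h4 : ∫ r, ((x:ℂ) + (r:ℂ))⁻¹ ∂ν = ((∫ r, (x + r)⁻¹ ∂ν : ℝ) : ℂ) := by
    rw [← integral_complex_ofReal]; simp
  rw [h4, this]
  push_cast
  rw [Complex.ofReal_cpow hx.le, Complex.ofReal_cpow hx.le]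
  push_cast
  rfl

/-- boundary function -/
noncomputable def bdH (α : ℝ) (w : ℂ) : ℂ :=
  -(Complex.exp (Real.pi * α * Complex.I) * w ^ ((α:ℂ) - 1)) /
    (1 + Complex.exp (Real.pi * α * Complex.I) * w ^ (α:ℂ))

lemma bdH_den_ne (α : ℝ) (hα0 : 0 < α) (hα1 : α < 1) (w : ℂ) (hre : 0 < w.re) (him : w.im ≤ 0) :
    1 + Complex.exp (Real.pi * α * Complex.I) * w ^ (α:ℂ) ≠ 0 := by
  have hw : w ≠ 0 := by rintro rfl; simp at hre
  intro h
  have harg : w.arg ≤ 0 := by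
    rcases him.eq_or_lt with h | h
    · exact (Complex.arg_eq_zero_iff.2 ⟨hre.le, h⟩).le
    · exact (Complex.arg_neg_iff.2 h).le
  have hpi := Real.pi_pos
  have harg2 := Complex.neg_pi_lt_arg w
  rw [Complex.cpow_def_of_ne_zero hw, ← Complex.exp_add] at h
  have h1 : Complex.exp (Real.pi * α * Complex.I + Complex.log w * α) = -1 := by
    linear_combination h
  have him : (Real.pi * α * Complex.I + Complex.log w * α).im = α * (Real.pi + w.arg) := by
    simp [Complex.log_im]; ring
  have h2 := Complex.log_exp (x := Real.pi * α * Complex.I + Complex.log w * α)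
    (by rw [him]; nlinarith) (by rw [him]; nlinarith)
  rw [h1, Complex.log_neg_one] at h2
  have h3 := congrArg Complex.im h2
  rw [him] at h3
  simp at h3
  nlinarith

lemma bdH_eq (α : ℝ) (w : ℂ) (him : w.im < 0) :
    (-w) ^ ((α:ℂ) - 1) / (1 + (-w) ^ (α:ℂ)) = bdH α w := by
  have hw : w ≠ 0 := by rintro rfl; simp at him
  have hlog : Complex.log (-w) = Complex.log w + Real.pi * Complex.I := by
    rw [Complex.log, Complex.log, Complex.arg_neg_eq_arg_add_pi_of_im_neg him, norm_neg]
    push_cast; ring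
  have h1 : (-w) ^ (α:ℂ) = Complex.exp (Real.pi * α * Complex.I) * w ^ (α:ℂ) := by
    rw [Complex.cpow_def_of_ne_zero (neg_ne_zero.2 hw), Complex.cpow_def_of_ne_zero hw, hlog,
      ← Complex.exp_add]
    congr 1; ring
  have h2 : (-w) ^ ((α:ℂ) - 1)
      = -(Complex.exp (Real.pi * α * Complex.I) * w ^ ((α:ℂ) - 1)) := by
    rw [Complex.cpow_sub _ _ (neg_ne_zero.2 hw), Complex.cpow_sub _ _ hw, h1]
    simp only [Complex.cpow_one]
    field_simp
  rw [bdH, h1, h2]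

lemma bdH_cont (α : ℝ) (hα0 : 0 < α) (hα1 : α < 1) :
    ContinuousOn (bdH α) {w | 0 < w.re ∧ w.im ≤ 0} := by
  intro w hw
  have hs : w ∈ Complex.slitPlane := Or.inl hw.1
  apply ContinuousAt.continuousWithinAt
  unfold bdH
  apply ContinuousAt.div
  · exact (continuousAt_const.mul (continuousAt_id.cpow continuousAt_const hs)).neg
  · exact continuousAt_const.add
      (continuousAt_const.mul (continuousAt_id.cpow continuousAt_const hs))
  · exact bdH_den_ne α hα0 hα1 w hw.1 hw.2

lemma bdH_im (α : ℝ) (hα0 : 0 < α) (hα1 : α < 1) (x : ℝ) (hx : 0 < x) :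
    -(bdH α x).im = Real.pi * (Real.sin (Real.pi * α) * x ^ (α - 1)
              / (Real.pi * (1 + x ^ (2 * α) + 2 * x ^ α * Real.cos (Real.pi * α)))) := by
  have hne := bdH_den_ne α hα0 hα1 x (by simpa using hx) (by simp)
  have hE : Complex.exp (Real.pi * α * Complex.I)
      = (Real.cos (Real.pi * α) : ℂ) + (Real.sin (Real.pi * α) : ℂ) * Complex.I := by
    rw [Complex.exp_mul_I]; push_cast; rfl
  have h1 : ((x:ℂ)) ^ (α:ℂ) = ((x ^ α : ℝ) : ℂ) := by rw [Complex.ofReal_cpow hx.le]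
  have h2 : ((x:ℂ)) ^ ((α:ℂ) - 1) = ((x ^ (α - 1) : ℝ) : ℂ) := by
    rw [Complex.ofReal_cpow hx.le]; push_cast; rfl
  have h3 : x ^ (2 * α) = (x ^ α) ^ 2 := by
    rw [← Real.rpow_natCast, ← Real.rpow_mul hx.le]; congr 1; push_cast; ring
  rw [bdH]
  rw [hE, h1] at hne ⊢
  clear hE h1
  rw [h2, h3]
  clear h2 h3
  generalize x ^ α = y at *
  generalize x ^ (α - 1) = v at *
  have hcs := Real.sin_sq_add_cos_sq (Real.pi * α)
  generalize Real.cos (Real.pi * α) = c at *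
  generalize Real.sin (Real.pi * α) = s at *
  have hn : Complex.normSq (1 + ((c:ℂ) + (s:ℂ) * Complex.I) * y) = 1 + y ^ 2 + 2 * y * c := by
    simp [Complex.normSq_apply]; linear_combination y ^ 2 * hcs
  have hn0 : 1 + y ^ 2 + 2 * y * c ≠ 0 := by
    rw [← hn]; exact (Complex.normSq_pos.2 hne).ne'
  rw [Complex.div_im, hn]
  have hpi := Real.pi_ne_zero
  simp
  field_simp
  ring

lemma arctan_lim (c : ℝ) : Tendsto (fun ε : ℝ => Real.arctan (c / ε)) (𝓝[>] 0)
    (𝓝 (Real.pi / 2 * (SignType.sign c : ℝ))) := by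
  rcases lt_trichotomy c 0 with h | h | h
  · have h1 : Tendsto (fun ε : ℝ => c / ε) (𝓝[>] 0) atBot := by
      simpa [div_eq_mul_inv] using tendsto_inv_nhdsGT_zero.const_mul_atTop_of_neg h
    have := (Real.tendsto_arctan_atBot.mono_right nhdsWithin_le_nhds).comp h1
    simpa [h, Function.comp_def, neg_div] using this
  · simp [h]
  · have h1 : Tendsto (fun ε : ℝ => c / ε) (𝓝[>] 0) atTop := by
      simpa [div_eq_mul_inv] using tendsto_inv_nhdsGT_zero.const_mul_atTop h
    have := (Real.tendsto_arctan_atTop.mono_right nhdsWithin_le_nhds).comp h1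
    simpa [h, Function.comp_def] using this

lemma poisson_integral (a b r ε : ℝ) (hε : 0 < ε) :
    ∫ x in a..b, ε / ((r - x) ^ 2 + ε ^ 2)
      = Real.arctan ((b - r) / ε) - Real.arctan ((a - r) / ε) := by
  have hpos : ∀ x : ℝ, (r - x) ^ 2 + ε ^ 2 ≠ 0 := fun x => by positivity
  apply intervalIntegral.integral_eq_sub_of_hasDerivAt
    (f := fun x => Real.arctan ((x - r) / ε))
  · intro x _
    have h1 : HasDerivAt (fun x => (x - r) / ε) (1 / ε) x :=
      ((hasDerivAt_id x).sub_const r).div_const ε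
    refine h1.arctan.congr_deriv ?_
    have := hpos x
    have h2 : (x - r) ^ 2 + ε ^ 2 ≠ 0 := by positivity
    have h3 : 1 + ((x - r) / ε) ^ 2 = ((r - x) ^ 2 + ε ^ 2) / ε ^ 2 := by
      field_simp; ring
    rw [h3]; field_simp
  · apply Continuous.intervalIntegrable
    exact continuous_const.div (by fun_prop) hpos

/-- the kernel -/
lemma neg_im_bdH (ν : Measure ℝ) [IsProbabilityMeasure ν] (h0 : ∀ᵐ r ∂ν, 0 < r)
    (α : ℝ) (hα0 : 0 < α) (hα1 : α < 1)
    (hreal : ∀ z : ℝ, 0 < z → ∫ r, (z + r)⁻¹ ∂ν = z ^ (α - 1) / (1 + z ^ α))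
    (x ε : ℝ) (hε : 0 < ε) :
    -(bdH α (x - ε * Complex.I)).im = ∫ r, ε / ((r - x) ^ 2 + ε ^ 2) ∂ν := by
  have him : ((x:ℂ) - ε * Complex.I).im = -ε := by simp
  rw [← bdH_eq α _ (by rw [him]; linarith), ← stieltjes_complex ν h0 α hα0 hα1 hreal _
    (by right; rw [Complex.neg_im, him]; simpa using hε.ne')]
  have hnorm : ∀ r : ℝ, ε ≤ ‖-((x:ℂ) - ε * Complex.I) + r‖ := by
    intro r
    have := Complex.abs_im_le_norm (-((x:ℂ) - ε * Complex.I) + r)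
    simp only [Complex.add_im, Complex.neg_im, him, Complex.ofReal_im] at this
    simpa [abs_of_pos hε] using this
  have hint : Integrable (fun r : ℝ => (-((x:ℂ) - ε * Complex.I) + r)⁻¹) ν := by
    refine Integrable.of_bound (C := ε⁻¹)
      (Measurable.aestronglyMeasurable (by fun_prop)) (Eventually.of_forall fun r => ?_)
    rw [norm_inv]
    exact inv_anti₀ hε (hnorm r)
  have h1 := integral_im (𝕜 := ℂ) hint
  simp only [RCLike.im_to_complex] at h1
  rw [← h1, ← integral_neg]
  congr 1
  ext r
  rw [Complex.inv_im, Complex.normSq_apply]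
  simp
  rw [neg_div, neg_neg]
  congr 1
  ring

lemma inversion (ν : Measure ℝ) [IsProbabilityMeasure ν] (h0 : ∀ᵐ r ∂ν, 0 < r)
    (α : ℝ) (hα0 : 0 < α) (hα1 : α < 1)
    (hreal : ∀ z : ℝ, 0 < z → ∫ r, (z + r)⁻¹ ∂ν = z ^ (α - 1) / (1 + z ^ α))
    (a b : ℝ) (ha : 0 < a) (hab : a < b) :
    (∫ x in a..b, -(bdH α x).im) = Real.pi / 2 * (ν.real (Icc a b) + ν.real (Ioo a b)) := by
  -- the left side is the limit
  have hcont : ContinuousOn (fun p : ℝ × ℝ => -(bdH α (p.1 - p.2 * Complex.I)).im)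
      (Icc a b ×ˢ Icc 0 1) := by
    apply ContinuousOn.neg
    apply Complex.continuous_im.comp_continuousOn
    apply (bdH_cont α hα0 hα1).comp (by fun_prop)
    rintro ⟨x, ε⟩ ⟨hx, hε⟩
    simp at hx hε ⊢
    exact ⟨by linarith, hε.1⟩
  obtain ⟨C, hC⟩ := (isCompact_Icc.prod isCompact_Icc).exists_bound_of_continuousOn hcont
  have hev : ∀ᶠ ε : ℝ in 𝓝[>] 0, ε ∈ Ioc (0:ℝ) 1 := Ioc_mem_nhdsGT one_pos
  have hsub : ∀ x, x ∈ uIoc a b → x ∈ Icc a b := fun x hx => by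
    rw [uIoc_of_le hab.le] at hx; exact ⟨hx.1.le, hx.2⟩
  have hL : Tendsto (fun ε : ℝ => ∫ x in a..b, -(bdH α (x - ε * Complex.I)).im) (𝓝[>] 0)
      (𝓝 (∫ x in a..b, -(bdH α x).im)) := by
    apply intervalIntegral.tendsto_integral_filter_of_dominated_convergence (fun _ => C)
    · filter_upwards [hev] with ε hε
      apply ContinuousOn.aestronglyMeasurable _ measurableSet_uIoc
      exact hcont.comp (f := fun x : ℝ => (x, ε)) (by fun_prop)
        (fun x hx => ⟨hsub x hx, hε.1.le, hε.2⟩)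
    · filter_upwards [hev] with ε hε
      refine Eventually.of_forall fun x hx => ?_
      exact hC (x, ε) ⟨hsub x hx, hε.1.le, hε.2⟩
    · exact intervalIntegrable_const
    · refine Eventually.of_forall fun x hx => ?_
      have h1 : ContinuousWithinAt (fun ε : ℝ => -(bdH α (x - ε * Complex.I)).im) (Icc 0 1) 0 :=
        (hcont.comp (f := fun ε : ℝ => (x, ε)) (s := Icc (0:ℝ) 1) (by fun_prop)
        (fun ε hε => ⟨hsub x hx, hε⟩)) 0 (by simp)
      have h2 : Tendsto (fun ε : ℝ => -(bdH α (x - ε * Complex.I)).im) (𝓝[Icc 0 1] 0)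
        (𝓝 (-(bdH α x).im)) := by simpa [ContinuousWithinAt] using h1
      apply h2.mono_left
      rw [nhdsWithin_le_iff]
      filter_upwards [hev] with ε hε using ⟨hε.1.le, hε.2⟩
  have hL2 : ∀ᶠ ε : ℝ in 𝓝[>] 0, ∫ x in a..b, -(bdH α (x - ε * Complex.I)).im
      = ∫ r, (Real.arctan ((b - r) / ε) - Real.arctan ((a - r) / ε)) ∂ν := by
    filter_upwards [hev] with ε hε
    have hε0 := hε.1
    simp_rw [neg_im_bdH ν h0 α hα0 hα1 hreal _ ε hε0]
    simp_rw [← poisson_integral a b _ ε hε0]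
    apply intervalIntegral_integral_swap
    have hfin : IsFiniteMeasure ((volume : Measure ℝ).restrict (uIoc a b)) := by
      rw [uIoc_of_le hab.le]; infer_instance
    refine Integrable.of_bound (C := ε⁻¹) (Measurable.aestronglyMeasurable
      (by unfold Function.uncurry; fun_prop)) (Eventually.of_forall fun p => ?_)
    simp only [Function.uncurry]
    rw [Real.norm_of_nonneg (by positivity), div_le_iff₀ (by positivity)]
    have : ε = ε⁻¹ * ε ^ 2 := by field_simp
    nth_rewrite 1 [this]
    gcongr
    nlinarith [sq_nonneg (p.2 - p.1)]
  have hR : Tendsto (fun ε : ℝ => ∫ r, (Real.arctan ((b - r) / ε) - Real.arctan ((a - r) / ε)) ∂ν)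
      (𝓝[>] 0) (𝓝 (∫ r, (Real.pi / 2 * (SignType.sign (b - r) : ℝ)
        - Real.pi / 2 * (SignType.sign (a - r) : ℝ)) ∂ν)) := by
    apply tendsto_integral_filter_of_dominated_convergence (fun _ => Real.pi)
    · exact Eventually.of_forall fun ε => Measurable.aestronglyMeasurable (by fun_prop)
    · refine Eventually.of_forall fun ε => Eventually.of_forall fun r => ?_
      rw [Real.norm_eq_abs, abs_le]
      constructor <;> linarith [Real.arctan_lt_pi_div_two ((b - r) / ε),
        Real.arctan_lt_pi_div_two ((a - r) / ε), Real.neg_pi_div_two_lt_arctan ((b - r) / ε),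
        Real.neg_pi_div_two_lt_arctan ((a - r) / ε)]
    · exact integrable_const _
    · exact Eventually.of_forall fun r => (arctan_lim _).sub (arctan_lim _)
  have heq := tendsto_nhds_unique (hL.congr' hL2) hR
  have hiIcc : Integrable ((Icc a b).indicator (1 : ℝ → ℝ)) ν :=
    (integrable_const (1:ℝ)).indicator measurableSet_Icc
  have hiIoo : Integrable ((Ioo a b).indicator (1 : ℝ → ℝ)) ν :=
    (integrable_const (1:ℝ)).indicator measurableSet_Ioo
  rw [heq, ← integral_indicator_one measurableSet_Icc, ← integral_indicator_one measurableSet_Ioo,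
    ← integral_add hiIcc hiIoo, ← integral_const_mul]
  congr 1
  ext r
  rcases lt_trichotomy r a with h | h | h
  · have h2 : r < b := h.trans hab
    simp [indicator, h2, h, h.not_ge, h.not_gt]
  · subst h
    simp [indicator, hab, hab.le]
  · rcases lt_trichotomy r b with h2 | h2 | h2
    · simp [indicator, h2, h, h2.le, h.le]; ring
    · subst h2; simp [indicator, h, h.le]
    · simp [indicator, h2, h, h.not_ge, h.not_gt, h2.not_ge, h2.not_gt]

lemma meas_Ioc (ν : Measure ℝ) [IsProbabilityMeasure ν] (h0 : ∀ᵐ r ∂ν, 0 < r)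
    (α : ℝ) (hα0 : 0 < α) (hα1 : α < 1)
    (hreal : ∀ z : ℝ, 0 < z → ∫ r, (z + r)⁻¹ ∂ν = z ^ (α - 1) / (1 + z ^ α))
    (a b : ℝ) (ha : 0 < a) (hab : a < b) :
    (∫ x in a..b, -(bdH α x).im) = Real.pi * ν.real (Ioc a b) := by
  have hpi := Real.pi_pos
  have hcont : ContinuousOn (fun x : ℝ => -(bdH α x).im) (Ioi 0) := by
    apply ContinuousOn.neg
    apply Complex.continuous_im.comp_continuousOn
    apply (bdH_cont α hα0 hα1).comp (by fun_prop)
    intro x hx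
    simpa using hx
  have hatom : ∀ c : ℝ, 0 < c → ν.real {c} = 0 := by
    intro c hc
    obtain ⟨C, hC⟩ := (isCompact_Icc (a := c) (b := c + 1)).exists_bound_of_continuousOn
      (hcont.mono fun x hx => hc.trans_le hx.1)
    have hle : ∀ᶠ δ in 𝓝[>] (0:ℝ), Real.pi / 2 * ν.real {c} ≤ C * δ := by
      filter_upwards [Ioc_mem_nhdsGT one_pos] with δ hδ
      have h1 := inversion ν h0 α hα0 hα1 hreal c (c + δ) hc (by linarith [hδ.1])
      have h2 := intervalIntegral.norm_integral_le_of_norm_le_const (a := c) (b := c + δ)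
        (f := fun x : ℝ => -(bdH α x).im) (C := C) (fun x hx => by
          rw [uIoc_of_le (by linarith [hδ.1])] at hx
          exact hC x ⟨hx.1.le, by linarith [hx.2, hδ.2]⟩)
      have h3 : ν.real {c} ≤ ν.real (Icc c (c + δ)) :=
        measureReal_mono (by simp [hδ.1.le])
      have h4 : 0 ≤ ν.real (Ioo c (c + δ)) := measureReal_nonneg
      rw [show c + δ - c = δ by ring, abs_of_pos hδ.1] at h2
      refine le_trans ?_ h2
      refine le_trans ?_ (le_abs_self _)
      rw [h1]
      gcongr
      linarith
    have ht : Tendsto (fun δ : ℝ => C * δ) (𝓝[>] 0) (𝓝 0) := by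
      have : Tendsto (fun δ : ℝ => C * δ) (𝓝 0) (𝓝 0) :=
        Continuous.tendsto' (by fun_prop) _ _ (by simp)
      exact this.mono_left nhdsWithin_le_nhds
    have := ge_of_tendsto ht hle
    have h5 : 0 ≤ ν.real {c} := measureReal_nonneg
    nlinarith
  rw [inversion ν h0 α hα0 hα1 hreal a b ha hab]
  have e1 : ν.real (Icc a b) = ν.real (Ioc a b) := by
    have : ν.real (Icc a b) ≤ ν.real {a} + ν.real (Ioc a b) := by
      rw [← Ioc_insert_left hab.le]; exact measureReal_union_le _ _
    rw [hatom a ha, zero_add] at this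
    exact le_antisymm this (measureReal_mono Ioc_subset_Icc_self)
  have e2 : ν.real (Ioo a b) = ν.real (Ioc a b) := by
    have : ν.real (Ioc a b) ≤ ν.real {b} + ν.real (Ioo a b) := by
      rw [← Ioo_insert_right hab]; exact measureReal_union_le _ _
    rw [hatom b (ha.trans hab), zero_add] at this
    exact le_antisymm (measureReal_mono Ioo_subset_Ioc_self) this
  rw [e1, e2]; ring

lemma meas_ext_pos (μ ν : Measure ℝ) [IsFiniteMeasure μ] (hμ : μ (Iic 0) = 0) (hν : ν (Iic 0) = 0)
    (h : ∀ a b : ℝ, 0 < a → a < b → μ (Ioc a b) = ν (Ioc a b)) : μ = ν := by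
  have h1 : ∀ b : ℝ, μ (Ioc 0 b) = ν (Ioc 0 b) := by
    intro b
    have hU : Ioc 0 b = ⋃ n : ℕ, Ioc (1 / ((n:ℝ) + 1)) b := by
      ext x
      simp only [mem_Ioc, mem_iUnion]
      constructor
      · rintro ⟨h1, h2⟩
        obtain ⟨n, hn⟩ := exists_nat_one_div_lt h1
        exact ⟨n, hn, h2⟩
      · rintro ⟨n, h1, h2⟩
        exact ⟨lt_trans (by positivity) h1, h2⟩
    have hmono : Monotone fun n : ℕ => Ioc (1 / ((n:ℝ) + 1)) b := by
      intro m n hmn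
      apply Ioc_subset_Ioc_left
      exact Nat.one_div_le_one_div hmn
    rw [hU, hmono.measure_iUnion, hmono.measure_iUnion]
    congr 1
    ext n
    rcases lt_or_ge (1 / ((n:ℝ) + 1)) b with hlt | hge
    · rw [h _ _ (by positivity) hlt]
    · rw [Ioc_eq_empty_of_le hge]; simp
  have h2 : ∀ (ρ : Measure ℝ), ρ (Iic 0) = 0 → ∀ a b : ℝ, a ≤ 0 → ρ (Ioc a b) = ρ (Ioc 0 b) := by
    intro ρ hρ a b ha
    apply le_antisymm _ (measure_mono (Ioc_subset_Ioc_left ha))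
    calc ρ (Ioc a b) ≤ ρ (Iic 0 ∪ Ioc 0 b) := measure_mono (by
          intro x hx
          rcases le_or_gt x 0 with h | h
          · exact Or.inl h
          · exact Or.inr ⟨h, hx.2⟩)
      _ ≤ ρ (Iic 0) + ρ (Ioc 0 b) := measure_union_le _ _
      _ = ρ (Ioc 0 b) := by rw [hρ, zero_add]
  apply Measure.ext_of_Ioc
  intro a b hab
  rcases le_or_gt a 0 with ha | ha
  · rw [h2 μ hμ a b ha, h2 ν hν a b ha, h1]
  · exact h a b ha hab

/-- Let `α ∈ (0,1)`. If `S` and `S'` are independent random variables with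
one and the same positive strictly stable distribution with exponent `α`, then the ratio
`S/S'` has an absolutely continuous distribution on `(0,∞)` with density
`p_α(x) = sin(πα)·x^(α-1) / (π·(1 + x^(2α) + 2·x^α·cos(πα)))`, `x > 0`. -/
theorem density_of_ratio_of_stables
    {Ω : Type*} [MeasurableSpace Ω] (P : Measure Ω) [IsProbabilityMeasure P]
    (α : ℝ) (hα0 : 0 < α) (hα1 : α < 1)
    (S S' : Ω → ℝ) (hSm : Measurable S) (hS'm : Measurable S')
    (hSnn : ∀ᵐ ω ∂P, 0 ≤ S ω) (hS'nn : ∀ᵐ ω ∂P, 0 ≤ S' ω)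
    (hS : ∀ s : ℝ, 0 ≤ s →
      ∫ ω, Real.exp (-(s * S ω)) ∂P = Real.exp (-(s ^ α)))
    (hS' : ∀ s : ℝ, 0 ≤ s →
      ∫ ω, Real.exp (-(s * S' ω)) ∂P = Real.exp (-(s ^ α)))
    (hindep : IndepFun S S' P) :
    Measure.map (fun ω => S ω / S' ω) P
      = volume.withDensity (fun x => ENNReal.ofReal
          (Set.indicator (Set.Ioi (0 : ℝ))
            (fun y => Real.sin (Real.pi * α) * y ^ (α - 1)
              / (Real.pi * (1 + y ^ (2 * α) + 2 * y ^ α * Real.cos (Real.pi * α)))) x)) := by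
  have hp := stable_pos P α hα0 S hSm hSnn hS
  have hp' := stable_pos P α hα0 S' hS'm hS'nn hS'
  have hRm : Measurable (fun ω => S ω / S' ω) := by fun_prop
  have hpi := Real.pi_pos
  set ν := Measure.map (fun ω => S ω / S' ω) P with hν
  have : IsProbabilityMeasure ν := Measure.isProbabilityMeasure_map hRm.aemeasurable
  have h0 : ∀ᵐ r ∂ν, 0 < r := by
    rw [hν, ae_map_iff hRm.aemeasurable measurableSet_Ioi]
    filter_upwards [hp, hp'] with ω h h' using div_pos h h'
  have hreal : ∀ z : ℝ, 0 < z → ∫ r, (z + r)⁻¹ ∂ν = z ^ (α - 1) / (1 + z ^ α) := by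
    intro z hz
    rw [hν, integral_map hRm.aemeasurable (Measurable.aestronglyMeasurable (by fun_prop))]
    exact stieltjes_real P α hα0 S S' hSm hS'm hSnn hS'nn hS hS' hindep z hz
  set p : ℝ → ℝ := fun y => Real.sin (Real.pi * α) * y ^ (α - 1)
              / (Real.pi * (1 + y ^ (2 * α) + 2 * y ^ α * Real.cos (Real.pi * α))) with hpdef
  have hHp : ∀ x : ℝ, 0 < x → p x = Real.pi⁻¹ * (-(bdH α x).im) := by
    intro x hx
    rw [bdH_im α hα0 hα1 x hx, hpdef]
    field_simp
  have hpcont : ContinuousOn p (Ioi 0) := by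
    have hcont : ContinuousOn (fun x : ℝ => Real.pi⁻¹ * (-(bdH α x).im)) (Ioi 0) := by
      apply ContinuousOn.mul continuousOn_const
      apply ContinuousOn.neg
      apply Complex.continuous_im.comp_continuousOn
      apply (bdH_cont α hα0 hα1).comp (by fun_prop)
      intro x hx
      simpa using hx
    exact hcont.congr hHp
  have hpnn : ∀ x : ℝ, 0 < x → 0 ≤ p x := by
    intro x hx
    have hs : 0 ≤ Real.sin (Real.pi * α) :=
      Real.sin_nonneg_of_nonneg_of_le_pi (by positivity) (by nlinarith)
    have hd : 0 ≤ 1 + x ^ (2 * α) + 2 * x ^ α * Real.cos (Real.pi * α) := by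
      have h3 : x ^ (2 * α) = (x ^ α) ^ 2 := by
        rw [← Real.rpow_natCast, ← Real.rpow_mul hx.le]; congr 1; push_cast; ring
      have hy : 0 ≤ x ^ α := by positivity
      rw [h3]
      nlinarith [Real.neg_one_le_cos (Real.pi * α), sq_nonneg (1 - x ^ α)]
    simp only [hpdef]
    positivity
  apply meas_ext_pos
  · have : ν {r | ¬ 0 < r} = 0 := h0
    simpa [Iic, not_lt] using this
  · rw [withDensity_apply _ measurableSet_Iic]
    rw [setLIntegral_congr_fun (g := fun _ => 0) measurableSet_Iic]
    · simp
    · intro x hx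
      have : x ∉ Ioi (0:ℝ) := by simpa using hx
      simp [indicator_of_notMem this]
  · intro a b ha hab
    rw [withDensity_apply _ measurableSet_Ioc]
    have hpos : ∀ x ∈ Ioc a b, 0 < x := fun x hx => ha.trans hx.1
    rw [setLIntegral_congr_fun (g := fun x => ENNReal.ofReal (p x)) measurableSet_Ioc
      (fun x hx => by simp only; rw [indicator_of_mem (show x ∈ Ioi (0:ℝ) from hpos x hx)])]
    have hint : IntegrableOn p (Ioc a b) :=
      ((hpcont.mono fun x hx => ha.trans_le hx.1).integrableOn_Icc).mono_set Ioc_subset_Icc_self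
    rw [← ofReal_integral_eq_lintegral_ofReal hint ((ae_restrict_iff' measurableSet_Ioc).2
      (Eventually.of_forall fun x hx => hpnn x (hpos x hx)))]
    rw [setIntegral_congr_fun measurableSet_Ioc (fun x hx => hHp x (hpos x hx)),
      integral_const_mul, ← intervalIntegral.integral_of_le hab.le,
      meas_Ioc ν h0 α hα0 hα1 hreal a b ha hab, inv_mul_cancel_left₀ hpi.ne',
      ofReal_measureReal]
end

section
/- Let α ∈ (0,2]. Let X₁, X₂, … be random variables, and for each n let T_n = T_n(X₁,…,X_n) be a statistic (a measurable function of X₁,…,X_n) that is asymptotically normal: there exist σ > 0 and θ ∈ ℝ such that P(σ·√n·(T_n − θ) < x) → Φ(x) for every x ∈ ℝ, where Φ is the standard normal distribution function. Let N₁, N₂, … be positive integer-valued random variables such that for each n, N_n is independent of the sequence X₁, X₂, …, and N_n → ∞ in probability, and define T_{N_n}(ω) = T_{N_n(ω)}(X₁(ω),…,X_{N_n(ω)}(ω)). Then the distributions of σ·√n·(T_{N_n} − θ) converge weakly, as n → ∞, to the Linnik distribution with parameter α if and only if N_n/n converges in distribution to (2M)^{-1}, where M is a Mittag-Leffler random variable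 with parameter α/2. -/
open MeasureTheory ProbabilityTheory Filter Set
open scoped Topology ENNReal

/-- The distribution function of a random variable `Y` under the measure `P`. -/
noncomputable def rvCDF {Ω : Type*} [MeasurableSpace Ω] (P : Measure Ω)
    (Y : Ω → ℝ) (x : ℝ) : ℝ :=
  (P {ω | Y ω ≤ x}).toReal

/-- Convergence in distribution (weak convergence of the laws), expressed via convergence
of the distribution functions at every continuity point of the limit distribution
function `F`. -/
def ConvInDistrib {Ω : Type*} [MeasurableSpace Ω] (P : Measure Ω)
    (Y : ℕ → Ω → ℝ) (F : ℝ → ℝ) : Prop :=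
  ∀ x : ℝ, ContinuousAt F x →
    Filter.Tendsto (fun n => rvCDF P (Y n) x) Filter.atTop (nhds (F x))


lemma aux_cdf_mono (ν : Measure ℝ) [IsProbabilityMeasure ν] :
    Monotone (fun x => (ν (Iic x)).toReal) := by
  intro x y hxy
  exact ENNReal.toReal_mono (measure_ne_top _ _) (measure_mono (Iic_subset_Iic.2 hxy))

lemma aux_Ioc (ν : Measure ℝ) [IsProbabilityMeasure ν] {a b : ℝ} (hab : a ≤ b) :
    (ν (Ioc a b)).toReal = (ν (Iic b)).toReal - (ν (Iic a)).toReal := by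
  have h := measureReal_sdiff (μ := ν) (s₁ := Iic b) (s₂ := Iic a) (Iic_subset_Iic.2 hab) measurableSet_Iic
  rw [Iic_sdiff_Iic] at h
  exact h

/-- convergence of cdfs at continuity points implies weak convergence -/
lemma aux_weak_of_cdf (μ : ℕ → ProbabilityMeasure ℝ) (ν : ProbabilityMeasure ℝ)
    (h : ∀ x : ℝ, ContinuousAt (fun x => ((ν : Measure ℝ) (Iic x)).toReal) x →
      Tendsto (fun n => ((μ n : Measure ℝ) (Iic x)).toReal) atTop
        (𝓝 ((ν : Measure ℝ) (Iic x)).toReal)) :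
    Tendsto μ atTop (𝓝 ν) := by
  set F : ℝ → ℝ := fun x => ((ν : Measure ℝ) (Iic x)).toReal with hF
  set S : Set (Set ℝ) := {s | ∃ a b, ContinuousAt F a ∧ ContinuousAt F b ∧ s = Ioc a b} with hS
  have hdense : Dense {x | ContinuousAt F x} := by
    have := (aux_cdf_mono (ν : Measure ℝ)).countable_not_continuousAt.dense_compl ℝ
    simpa [compl_ofPred] using this
  have hpi : IsPiSystem S := by
    rintro _ ⟨a, b, ha, hb, rfl⟩ _ ⟨c, d, hc, hd, rfl⟩ -
    refine ⟨max a c, min b d, ?_, ?_, Ioc_inter_Ioc⟩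
    · rcases max_choice a c with h | h <;> rw [h] <;> assumption
    · rcases min_choice b d with h | h <;> rw [h] <;> assumption
  refine hpi.tendsto_probabilityMeasure_of_tendsto_of_mem ?_ ?_ ?_
  · rintro _ ⟨a, b, ha, hb, rfl⟩
    exact measurableSet_Ioc
  · intro u hu x hx
    obtain ⟨l, r, hlr, hsub⟩ := mem_nhds_iff_exists_Ioo_subset.1 (hu.mem_nhds hx)
    obtain ⟨a, ha, ha'⟩ := hdense.exists_between hlr.1
    obtain ⟨b, hb, hb'⟩ := hdense.exists_between hlr.2
    refine ⟨Ioc a b, ⟨a, b, ha, hb, rfl⟩, Ioc_mem_nhds ha'.2 hb'.1, ?_⟩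
    intro y hy
    exact hsub ⟨ha'.1.trans hy.1, hy.2.trans_lt hb'.2⟩
  · rintro _ ⟨a, b, ha, hb, rfl⟩
    rcases le_total a b with hab | hab
    · rw [← NNReal.tendsto_coe]
      have : Tendsto (fun n => ((μ n : Measure ℝ) (Ioc a b)).toReal) atTop
        (𝓝 ((ν : Measure ℝ) (Ioc a b)).toReal) := by
        simp_rw [aux_Ioc _ hab]
        exact (h b hb).sub (h a ha)
      exact this
    · simp [Ioc_eq_empty_of_le hab]

/-- weak convergence implies convergence of cdfs at non-atoms -/
lemma aux_cdf_of_weak (μ : ℕ → ProbabilityMeasure ℝ) (ν : ProbabilityMeasure ℝ)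
    (h : Tendsto μ atTop (𝓝 ν)) (x : ℝ) (hx : (ν : Measure ℝ) {x} = 0) :
    Tendsto (fun n => ((μ n : Measure ℝ) (Iic x)).toReal) atTop
        (𝓝 ((ν : Measure ℝ) (Iic x)).toReal) := by
  have := ProbabilityMeasure.tendsto_measure_of_null_frontier_of_tendsto' h (E := Iic x)
    (by rw [frontier_Iic]; exact hx)
  exact (ENNReal.tendsto_toReal (measure_ne_top _ _)).comp this

/-- continuity point of cdf is not an atom -/
lemma aux_atom (ν : Measure ℝ) [IsProbabilityMeasure ν] (x : ℝ)
    (hx : ContinuousAt (fun x => (ν (Iic x)).toReal) x) : ν {x} = 0 := by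
  have h1 : ∀ y < x, (ν {x}).toReal ≤ (ν (Iic x)).toReal - (ν (Iic y)).toReal := by
    intro y hy
    rw [← aux_Ioc ν hy.le]
    exact ENNReal.toReal_mono (measure_ne_top _ _) (measure_mono (by simpa using hy))
  have h2 : Tendsto (fun y => (ν (Iic x)).toReal - (ν (Iic y)).toReal) (𝓝[<] x) (𝓝 0) := by
    have := (tendsto_const_nhds (x := (ν (Iic x)).toReal)).sub (hx.tendsto.mono_left (nhdsWithin_le_nhds (s := Iio x)))
    simpa using this
  have h3 : (ν {x}).toReal ≤ 0 := ge_of_tendsto h2 (by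
    filter_upwards [self_mem_nhdsWithin] with y hy using h1 y hy)
  have h4 : (ν {x}).toReal = 0 := le_antisymm h3 ENNReal.toReal_nonneg
  rcases (ENNReal.toReal_eq_zero_iff _).1 h4 with h | h
  · exact h
  · exact absurd h (measure_ne_top _ _)

/-- Moments on [0,1] determine weak convergence. -/
lemma aux_weak_of_moments (μ : ℕ → ProbabilityMeasure ℝ) (ν : ProbabilityMeasure ℝ)
    (hμ : ∀ n, ∀ᵐ y ∂(μ n : Measure ℝ), y ∈ Icc (0:ℝ) 1) (hν : ∀ᵐ y ∂(ν : Measure ℝ), y ∈ Icc (0:ℝ) 1)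
    (h : ∀ k : ℕ, Tendsto (fun n => ∫ y, y ^ k ∂(μ n : Measure ℝ)) atTop (𝓝 (∫ y, y ^ k ∂(ν : Measure ℝ)))) :
    Tendsto μ atTop (𝓝 ν) := by
  have hint : ∀ (ρ : ProbabilityMeasure ℝ), (∀ᵐ y ∂(ρ : Measure ℝ), y ∈ Icc (0:ℝ) 1) → ∀ g : ℝ → ℝ,
      Continuous g → Integrable g (ρ : Measure ℝ) := by
    intro ρ hρ g hg
    obtain ⟨C, hC⟩ := isCompact_Icc.exists_bound_of_continuousOn (s := Icc (0:ℝ) 1) hg.continuousOn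
    refine Integrable.of_bound hg.aestronglyMeasurable C ?_
    filter_upwards [hρ] with y hy using hC y hy
  have hpoly : ∀ p : Polynomial ℝ, Tendsto (fun n => ∫ y, p.eval y ∂(μ n : Measure ℝ)) atTop
      (𝓝 (∫ y, p.eval y ∂(ν : Measure ℝ))) := by
    intro p
    induction p using Polynomial.induction_on' with
    | add p q hp hq =>
      have e : ∀ (ρ : ProbabilityMeasure ℝ), (∀ᵐ y ∂(ρ : Measure ℝ), y ∈ Icc (0:ℝ) 1) →
        ∫ y, (p + q).eval y ∂(ρ : Measure ℝ) = ∫ y, p.eval y ∂(ρ : Measure ℝ) + ∫ y, q.eval y ∂(ρ : Measure ℝ) := by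
        intro ρ hρ
        simp_rw [Polynomial.eval_add]
        exact integral_add (hint ρ hρ _ p.continuous) (hint ρ hρ _ q.continuous)
      rw [e ν hν]
      simp_rw [fun n => e (μ n) (hμ n)]
      exact hp.add hq
    | monomial k a =>
      simp only [Polynomial.eval_monomial, integral_const_mul]
      exact (h k).const_mul a
  rw [ProbabilityMeasure.tendsto_iff_forall_integral_tendsto]
  intro f
  rw [Metric.tendsto_atTop]
  intro ε hε
  obtain ⟨p, hp⟩ := exists_polynomial_near_of_continuousOn 0 1 f f.continuous.continuousOn (ε/3) (by positivity)
  have key : ∀ (ρ : ProbabilityMeasure ℝ), (∀ᵐ y ∂(ρ : Measure ℝ), y ∈ Icc (0:ℝ) 1) →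
      |∫ y, p.eval y ∂(ρ : Measure ℝ) - ∫ y, f y ∂(ρ : Measure ℝ)| ≤ ε/3 := by
    intro ρ hρ
    rw [← integral_sub (hint ρ hρ _ p.continuous) (hint ρ hρ _ f.continuous)]
    have := norm_integral_le_of_norm_le_const (μ := (ρ : Measure ℝ)) (f := fun y => p.eval y - f y) (C := ε/3) (by
      filter_upwards [hρ] with y hy using (hp y hy).le)
    simpa using this
  obtain ⟨n0, hn0⟩ := Metric.tendsto_atTop.1 (hpoly p) (ε/3) (by positivity)
  refine ⟨n0, fun n hn => ?_⟩
  have a1 := key (μ n) (hμ n)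
  have a2 := key ν hν
  have a3 := hn0 n hn
  rw [Real.dist_eq] at a3 ⊢
  rw [abs_le] at a1 a2
  rw [abs_lt] at a3 ⊢
  constructor <;> linarith [a1.1, a1.2, a2.1, a2.2, a3.1, a3.2]

/-- Polya-type uniformity. -/
lemma aux_polya (F G : ℕ → ℝ → ℝ) (Φ : ℝ → ℝ) (hΦm : Monotone Φ) (hΦc : Continuous Φ)
    (hΦ0 : Tendsto Φ atBot (𝓝 0)) (hΦ1 : Tendsto Φ atTop (𝓝 1))
    (hG0 : ∀ k x, 0 ≤ G k x) (hG1 : ∀ k x, G k x ≤ 1)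
    (h1 : ∀ k x y, x < y → F k x ≤ G k y) (h2 : ∀ k x y, x < y → G k x ≤ F k y)
    (hF : ∀ x, Tendsto (fun k => F k x) atTop (𝓝 (Φ x))) :
    ∀ ε > 0, ∃ K, ∀ k ≥ K, ∀ x, |G k x - Φ x| ≤ ε := by
  intro ε hε
  obtain ⟨m, hm⟩ := exists_nat_gt (3/ε)
  have hm0 : (0:ℝ) < m := lt_trans (by positivity) hm
  have hmε : 3 / (m:ℝ) ≤ ε := by
    rw [div_lt_iff₀ hε] at hm
    rw [div_le_iff₀ hm0]; linarith
  have hb0 : ∀ x, 0 ≤ Φ x := fun x => hΦm.le_of_tendsto hΦ0 x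
  have hb1 : ∀ x, Φ x ≤ 1 := fun x => hΦm.ge_of_tendsto hΦ1 x
  have hex : ∀ j : ℕ, 0 < j → j < m → ∃ q, Φ q = (j:ℝ)/m := by
    intro j hj hjm
    refine mem_range_of_exists_le_of_exists_ge hΦc ?_ ?_
    · have : (0:ℝ) < j/m := by positivity
      exact ((hΦ0.eventually (gt_mem_nhds this)).exists).imp fun _ h => le_of_lt h
    · have : (j:ℝ)/m < 1 := by rw [div_lt_one hm0]; exact_mod_cast hjm
      exact ((hΦ1.eventually (lt_mem_nhds this)).exists).imp fun _ h => le_of_lt h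
  choose! q hq using hex
  have hev : ∀ᶠ k in atTop, ∀ j ∈ Finset.range m, |F k (q j) - Φ (q j)| < 1/m := by
    rw [Filter.eventually_all_finset]
    intro j _
    have := Metric.tendsto_atTop.1 (hF (q j)) (1/m) (by positivity)
    obtain ⟨K, hK⟩ := this
    filter_upwards [eventually_ge_atTop K] with k hk
    simpa [Real.dist_eq] using hK k hk
  obtain ⟨K, hK⟩ := eventually_atTop.1 hev
  refine ⟨K, fun k hk x => ?_⟩
  have hKk := hK k hk
  set j := ⌊m * Φ x⌋₊ with hj
  have hj1 : (j:ℝ) ≤ m * Φ x := Nat.floor_le (mul_nonneg hm0.le (hb0 x))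
  have hj2 : m * Φ x < j + 1 := Nat.lt_floor_add_one _
  have e1 : 1 / (m:ℝ) * m = 1 := by field_simp
  have e3 : 3 / (m:ℝ) * m = 3 := by field_simp
  refine le_trans ?_ hmε
  rw [abs_le]
  have hlow : (j:ℝ) - 2 ≤ m * G k x := by
    by_cases hc : 2 ≤ j
    · have hjm : j - 1 < m := by
        have : (j:ℝ) ≤ m := hj1.trans (by nlinarith [hb1 x])
        have : j ≤ m := by exact_mod_cast this
        omega
      have hqj := hq (j-1) (by omega) hjm
      have hcast : ((j-1 : ℕ):ℝ) = j - 1 := by push_cast [Nat.cast_sub (by omega : 1 ≤ j)]; ring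
      rw [hcast] at hqj
      have hlt : q (j-1) < x := by
        by_contra hcon
        have := hΦm (not_lt.1 hcon)
        rw [hqj, le_div_iff₀ hm0] at this
        nlinarith
      have a := hKk (j-1) (Finset.mem_range.2 hjm)
      rw [abs_lt, hqj] at a
      have b := h1 k _ _ hlt
      have c : ((j:ℝ)-1)/m * m = j - 1 := by field_simp
      have d : ((j:ℝ) - 1)/m - 1/m ≤ G k x := by linarith [a.1]
      have := mul_le_mul_of_nonneg_right d hm0.le
      rw [sub_mul, c, e1] at this
      linarith
    · have : (j:ℝ) < 2 := by exact_mod_cast not_le.1 hc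
      have := mul_nonneg hm0.le (hG0 k x)
      linarith
  have hup : m * G k x ≤ j + 2 := by
    by_cases hc : j + 1 < m
    · have hqj := hq (j+1) (by omega) hc
      have hlt : x < q (j+1) := by
        by_contra hcon
        have := hΦm (not_lt.1 hcon)
        rw [hqj, div_le_iff₀ hm0] at this
        push_cast at this
        nlinarith
      have a := hKk (j+1) (Finset.mem_range.2 hc)
      rw [abs_lt, hqj] at a
      push_cast at a
      have b := h2 k _ _ hlt
      have c : ((j:ℝ)+1)/m * m = j + 1 := by field_simp
      have d : G k x ≤ ((j:ℝ) + 1)/m + 1/m := by linarith [a.2]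
      have := mul_le_mul_of_nonneg_right d hm0.le
      rw [add_mul, c, e1] at this
      linarith
    · have : (m:ℝ) ≤ j + 1 := by exact_mod_cast not_lt.1 hc
      nlinarith [hG1 k x]
  constructor
  · by_contra hcon
    push Not at hcon
    have := mul_lt_mul_of_pos_right hcon hm0
    rw [neg_mul, e3] at this
    nlinarith
  · by_contra hcon
    push Not at hcon
    have := mul_lt_mul_of_pos_right hcon hm0
    rw [e3] at this
    nlinarith

noncomputable def auxΦ (x : ℝ) : ℝ := (gaussianReal 0 1 (Iic x)).toReal

lemma auxΦ_mono : Monotone auxΦ := aux_cdf_mono _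

lemma auxΦ_nonneg (x : ℝ) : 0 ≤ auxΦ x := ENNReal.toReal_nonneg

lemma auxΦ_le_one (x : ℝ) : auxΦ x ≤ 1 := by
  have := prob_le_one (μ := gaussianReal 0 1) (s := Iic x)
  exact ENNReal.toReal_mono ENNReal.one_ne_top this

lemma auxΦ_eq_cdf : auxΦ = cdf (gaussianReal 0 1) := by
  ext x
  rw [cdf_eq_real]; rfl

lemma aux_gauss_singleton (x : ℝ) : gaussianReal 0 1 {x} = 0 := by
  have := nullSingletonClass_gaussianReal (μ := 0) (v := 1) one_ne_zero
  exact measure_singleton x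

lemma auxΦ_Iio (x : ℝ) : (gaussianReal 0 1 (Iio x)).toReal = auxΦ x := by
  have := nullSingletonClass_gaussianReal (μ := 0) (v := 1) one_ne_zero
  unfold auxΦ
  rw [measure_congr Iio_ae_eq_Iic]

lemma auxΦ_continuous : Continuous auxΦ := by
  rw [auxΦ_eq_cdf, continuous_iff_continuousAt]
  intro x
  rw [(monotone_cdf (gaussianReal 0 1)).continuousAt_iff_leftLim_eq_rightLim]
  have h := StieltjesFunction.measure_singleton (cdf (gaussianReal 0 1)) x
  rw [measure_cdf, aux_gauss_singleton] at h
  have h1 := ENNReal.ofReal_eq_zero.1 h.symm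
  have h2 := (monotone_cdf (gaussianReal 0 1)).leftLim_le (le_refl x)
  rw [StieltjesFunction.rightLim_eq]
  linarith

noncomputable def auxMix {Ω : Type*} [MeasurableSpace Ω] (Q : Measure Ω) (U : Ω → ℝ) : Measure ℝ :=
  (Q.prod (gaussianReal 0 1)).map (fun p => p.2 * √(U p.1))

lemma auxMix_meas {Ω : Type*} [MeasurableSpace Ω] (U : Ω → ℝ) (hU : Measurable U) :
    Measurable (fun p : Ω × ℝ => p.2 * √(U p.1)) := by fun_prop

lemma auxMix_prob {Ω : Type*} [MeasurableSpace Ω] (Q : Measure Ω) [IsProbabilityMeasure Q]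
    (U : Ω → ℝ) (hU : Measurable U) : IsProbabilityMeasure (auxMix Q U) :=
  Measure.isProbabilityMeasure_map (auxMix_meas U hU).aemeasurable

lemma auxMix_cdf {Ω : Type*} [MeasurableSpace Ω] (Q : Measure Ω) [IsProbabilityMeasure Q]
    (U : Ω → ℝ) (hU : Measurable U) (hpos : ∀ᵐ ω ∂Q, 0 < U ω) (x : ℝ) :
    (auxMix Q U (Iic x)).toReal = ∫ ω, auxΦ (x * √((U ω)⁻¹)) ∂Q := by
  unfold auxMix auxΦ
  rw [Measure.map_apply (auxMix_meas U hU) measurableSet_Iic,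
    Measure.prod_apply ((auxMix_meas U hU) measurableSet_Iic)]
  rw [integral_toReal]
  · congr 1
    apply lintegral_congr_ae
    filter_upwards [hpos] with ω hω
    congr 1
    ext g
    have hs : 0 < √(U ω) := Real.sqrt_pos.2 hω
    simp only [mem_preimage, mem_Iic, Real.sqrt_inv, ← div_eq_mul_inv]
    rw [le_div_iff₀ hs]
  · have : Measurable (fun y => gaussianReal 0 1 (Iic y)) :=
      (show Monotone (fun y => gaussianReal 0 1 (Iic y)) from
        fun a b hab => measure_mono (Iic_subset_Iic.2 hab)).measurable
    exact (this.comp (by fun_prop : Measurable fun ω => x * √((U ω)⁻¹))).aemeasurable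
  · exact Eventually.of_forall fun _ => measure_lt_top _ _

lemma auxMix_charFun {Ω : Type*} [MeasurableSpace Ω] (Q : Measure Ω) [IsProbabilityMeasure Q]
    (U : Ω → ℝ) (hU : Measurable U) (hpos : ∀ᵐ ω ∂Q, 0 ≤ U ω) (t : ℝ) :
    charFun (auxMix Q U) t = ((∫ ω, Real.exp (-(t^2/2 * U ω)) ∂Q : ℝ) : ℂ) := by
  unfold auxMix
  rw [charFun_apply_real, integral_map (auxMix_meas U hU).aemeasurable (by fun_prop),
    integral_prod]
  · rw [← integral_complex_ofReal]
    apply integral_congr_ae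
    filter_upwards [hpos] with ω hω
    have h := charFun_gaussianReal (μ := 0) (v := 1) (t * √(U ω))
    rw [charFun_apply_real] at h
    have e : ∀ g : ℝ, Complex.exp (t * ((g * √(U ω) : ℝ) : ℂ) * Complex.I)
      = Complex.exp (((t * √(U ω) : ℝ) : ℂ) * g * Complex.I) := by
      intro g; congr 1; push_cast; ring
    simp only [e]
    rw [h]
    push_cast
    congr 1
    have : ((√(U ω) : ℝ) : ℂ)^2 = (U ω : ℂ) := by
      rw [← Complex.ofReal_pow, Real.sq_sqrt hω]
    rw [mul_pow, this]
    simp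
    ring
  · refine Integrable.of_bound (C := 1) (by fun_prop) (Eventually.of_forall fun p => ?_)
    rw [Complex.norm_exp]
    simp

lemma aux_map_cdf {Ω : Type*} [MeasurableSpace Ω] (Q : Measure Ω) (V : Ω → ℝ) (hV : Measurable V)
    (x : ℝ) : ((Q.map V) (Iic x)).toReal = rvCDF Q V x := by
  rw [Measure.map_apply hV measurableSet_Iic]; rfl

lemma aux_intΦ {Ω : Type*} [MeasurableSpace Ω] (Q : Measure Ω) [IsProbabilityMeasure Q]
    (V : Ω → ℝ) (hV : Measurable V) : Integrable (fun ω => auxΦ (V ω)) Q := by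
  refine Integrable.of_bound (C := 1) (auxΦ_continuous.measurable.comp hV).aestronglyMeasurable
    (Eventually.of_forall fun p => ?_)
  rw [Real.norm_eq_abs, abs_of_nonneg (auxΦ_nonneg _)]
  exact auxΦ_le_one _

lemma aux_core {Ω : Type*} [MeasurableSpace Ω] (P : Measure Ω) [IsProbabilityMeasure P]
    {Ω' : Type*} [MeasurableSpace Ω'] (P' : Measure Ω') [IsProbabilityMeasure P']
    (V : ℕ → Ω → ℝ) (hV : ∀ n, Measurable (V n)) (hV0 : ∀ n ω, 0 ≤ V n ω)
    (hVpos : ∀ n ≥ 1, ∀ ω, 0 < V n ω)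
    (W : Ω' → ℝ) (hW : Measurable W) (hWpos : ∀ᵐ ω ∂P', 0 < W ω) :
    (∀ x : ℝ, Tendsto (fun n => ∫ ω, auxΦ (x * √(V n ω)) ∂P) atTop
      (𝓝 (∫ ω, auxΦ (x * √(W ω)) ∂P'))) ↔ ConvInDistrib P V (rvCDF P' W) := by
  constructor
  · intro h
    let mn : ℕ → ProbabilityMeasure ℝ := fun n => ⟨auxMix P (fun ω => (V n ω)⁻¹), auxMix_prob P _ (hV n).inv⟩
    let m : ProbabilityMeasure ℝ := ⟨auxMix P' (fun ω => (W ω)⁻¹), auxMix_prob P' _ hW.inv⟩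
    have hweak : Tendsto mn atTop (𝓝 m) := by
      apply aux_weak_of_cdf
      intro x _
      have e1 : ((m : Measure ℝ) (Iic x)).toReal = ∫ ω, auxΦ (x * √(W ω)) ∂P' := by
        have := auxMix_cdf P' (fun ω => (W ω)⁻¹) hW.inv (by
          filter_upwards [hWpos] with ω hω using inv_pos.2 hω) x
        simp only [inv_inv] at this
        exact this
      rw [e1]
      refine (h x).congr' ?_
      filter_upwards [eventually_ge_atTop 1] with n hn
      have := auxMix_cdf P (fun ω => (V n ω)⁻¹) (hV n).inv (Eventually.of_forall fun ω => inv_pos.2 (hVpos n hn ω)) x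
      simp only [inv_inv] at this
      exact this.symm
    have hlap : ∀ s : ℝ, 0 ≤ s → Tendsto (fun n => ∫ ω, Real.exp (-(s * (V n ω)⁻¹)) ∂P) atTop
        (𝓝 (∫ ω, Real.exp (-(s * (W ω)⁻¹)) ∂P')) := by
      intro s hs
      have h1 := ProbabilityMeasure.tendsto_iff_tendsto_charFun.1 hweak (√(2*s))
      have e1 : charFun (m : Measure ℝ) (√(2*s)) = _ := auxMix_charFun P' (fun ω => (W ω)⁻¹) hW.inv
        (by filter_upwards [hWpos] with ω hω using (inv_pos.2 hω).le) (√(2*s))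
      have e2 : ∀ n, charFun (mn n : Measure ℝ) (√(2*s)) = _ := fun n =>
        auxMix_charFun P (fun ω => (V n ω)⁻¹) (hV n).inv
        (Eventually.of_forall fun ω => inv_nonneg.2 (hV0 n ω)) (√(2*s))
      rw [e1] at h1
      simp_rw [e2] at h1
      have e3 : √(2*s)^2/2 = s := by rw [Real.sq_sqrt (by positivity)]; ring
      rw [e3] at h1
      exact (Complex.continuous_re.tendsto _).comp h1
    have hYm : ∀ n, Measurable (fun ω => Real.exp (-(V n ω)⁻¹)) := fun n =>
      Real.measurable_exp.comp (hV n).inv.neg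
    have hYm' : Measurable (fun ω => Real.exp (-(W ω)⁻¹)) := Real.measurable_exp.comp hW.inv.neg
    let yn : ℕ → ProbabilityMeasure ℝ := fun n => ⟨P.map (fun ω => Real.exp (-(V n ω)⁻¹)),
      Measure.isProbabilityMeasure_map (hYm n).aemeasurable⟩
    let y : ProbabilityMeasure ℝ := ⟨P'.map (fun ω => Real.exp (-(W ω)⁻¹)),
      Measure.isProbabilityMeasure_map hYm'.aemeasurable⟩
    have hyweak : Tendsto yn atTop (𝓝 y) := by
      apply aux_weak_of_moments
      · intro n
        refine (ae_map_iff (hYm n).aemeasurable measurableSet_Icc).2 (Eventually.of_forall fun ω => ?_)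
        refine ⟨(Real.exp_pos _).le, ?_⟩
        rw [Real.exp_le_one_iff]
        exact neg_nonpos.2 (inv_nonneg.2 (hV0 n ω))
      · refine (ae_map_iff hYm'.aemeasurable measurableSet_Icc).2 ?_
        filter_upwards [hWpos] with ω hω
        refine ⟨(Real.exp_pos _).le, ?_⟩
        rw [Real.exp_le_one_iff]
        exact neg_nonpos.2 (inv_nonneg.2 hω.le)
      · intro k
        have e1 : ∫ z, z ^ k ∂(y : Measure ℝ) = ∫ ω, Real.exp (-(k * (W ω)⁻¹)) ∂P' := by
          refine (integral_map hYm'.aemeasurable (by fun_prop)).trans ?_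
          congr 1; ext ω
          rw [← Real.exp_nat_mul]; congr 1; ring
        have e2 : ∀ n, ∫ z, z ^ k ∂(yn n : Measure ℝ) = ∫ ω, Real.exp (-(k * (V n ω)⁻¹)) ∂P := by
          intro n
          refine (integral_map (hYm n).aemeasurable (by fun_prop)).trans ?_
          congr 1; ext ω
          rw [← Real.exp_nat_mul]; congr 1; ring
        rw [e1]
        simp_rw [e2]
        exact hlap k (Nat.cast_nonneg k)
    intro x hx
    rcases le_or_gt x 0 with hx0 | hx0
    · have e1 : rvCDF P' W x = 0 := by
        unfold rvCDF
        have : P' {ω | W ω ≤ x} = 0 := by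
          rw [measure_eq_zero_iff_ae_notMem]
          filter_upwards [hWpos] with ω hω hcon
          exact absurd (lt_of_lt_of_le hω (le_trans hcon hx0)) (lt_irrefl _)
        rw [this]; rfl
      rw [e1]
      refine tendsto_const_nhds.congr' ?_
      filter_upwards [eventually_ge_atTop 1] with n hn
      have : {ω | V n ω ≤ x} = ∅ := by
        ext ω
        simp only [mem_ofPred_eq, mem_empty_iff_false, iff_false, not_le]
        exact hx0.trans_lt (hVpos n hn ω)
      unfold rvCDF
      rw [this]; simp
    · have key : ∀ v : ℝ, 0 < v → (v ≤ x ↔ Real.exp (-v⁻¹) ≤ Real.exp (-x⁻¹)) := by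
        intro v hv
        rw [Real.exp_le_exp, neg_le_neg_iff, inv_le_inv₀ hx0 hv]
      have hWprob : IsProbabilityMeasure (P'.map W) := Measure.isProbabilityMeasure_map hW.aemeasurable
      have hatom : (y : Measure ℝ) {Real.exp (-x⁻¹)} = 0 := by
        have h1 : (P'.map W) {x} = 0 := by
          apply aux_atom
          simp_rw [aux_map_cdf P' W hW]
          exact hx
        rw [Measure.map_apply hW (measurableSet_singleton x)] at h1
        refine (Measure.map_apply hYm' (measurableSet_singleton _)).trans ?_
        convert! h1 using 2
        ext ω
        simp
      have h1 := aux_cdf_of_weak yn y hyweak _ hatom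
      have e1 : ((y : Measure ℝ) (Iic (Real.exp (-x⁻¹)))).toReal = rvCDF P' W x := by
        refine (aux_map_cdf P' _ hYm' _).trans ?_
        unfold rvCDF
        congr 1
        apply measure_congr
        filter_upwards [hWpos] with ω hω
        exact propext (key _ hω).symm
      rw [e1] at h1
      refine h1.congr' ?_
      filter_upwards [eventually_ge_atTop 1] with n hn
      refine (aux_map_cdf P _ (hYm n) _).trans ?_
      unfold rvCDF
      congr 2
      ext ω
      exact (key _ (hVpos n hn ω)).symm
  · intro h x
    let mn : ℕ → ProbabilityMeasure ℝ := fun n => ⟨P.map (V n), Measure.isProbabilityMeasure_map (hV n).aemeasurable⟩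
    let m : ProbabilityMeasure ℝ := ⟨P'.map W, Measure.isProbabilityMeasure_map hW.aemeasurable⟩
    have hweak : Tendsto mn atTop (𝓝 m) := by
      apply aux_weak_of_cdf
      intro z hz
      have e1 : ∀ z, ((m : Measure ℝ) (Iic z)).toReal = rvCDF P' W z := aux_map_cdf P' W hW
      have e2 : ∀ n, ((mn n : Measure ℝ) (Iic z)).toReal = rvCDF P (V n) z := fun n => aux_map_cdf P (V n) (hV n) z
      simp_rw [e1] at hz ⊢
      simp_rw [e2]
      exact h z hz
    have hc : Continuous (fun v : ℝ => auxΦ (x * √v)) := auxΦ_continuous.comp (by fun_prop)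
    let f : BoundedContinuousFunction ℝ ℝ := BoundedContinuousFunction.ofNormedAddCommGroup
      (fun v : ℝ => auxΦ (x * √v)) hc 1 (fun v => by
        rw [Real.norm_eq_abs, abs_of_nonneg (auxΦ_nonneg _)]
        exact auxΦ_le_one _)
    have h1 := ProbabilityMeasure.tendsto_iff_forall_integral_tendsto.1 hweak f
    have e1 : ∫ v, f v ∂(m : Measure ℝ) = ∫ ω, auxΦ (x * √(W ω)) ∂P' :=
      integral_map hW.aemeasurable hc.aestronglyMeasurable
    have e2 : ∀ n, ∫ v, f v ∂(mn n : Measure ℝ) = ∫ ω, auxΦ (x * √(V n ω)) ∂P := fun n =>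
      integral_map (hV n).aemeasurable hc.aestronglyMeasurable
    rw [e1] at h1
    simp_rw [e2] at h1
    exact h1

lemma aux_uniform {Ω : Type*} [MeasurableSpace Ω] (P : Measure Ω) [IsProbabilityMeasure P]
    (S : ℕ → Ω → ℝ)
    (hAN : ∀ x : ℝ, Tendsto (fun n : ℕ => (P {ω | S n ω < x}).toReal)
        atTop (𝓝 ((gaussianReal 0 1 (Iio x)).toReal))) :
    ∀ ε > 0, ∃ K, ∀ k ≥ K, ∀ x, |rvCDF P (S k) x - auxΦ x| ≤ ε := by
  refine aux_polya (fun k x => (P {ω | S k ω < x}).toReal) (fun k => rvCDF P (S k)) auxΦ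
    auxΦ_mono auxΦ_continuous ?_ ?_ ?_ ?_ ?_ ?_ ?_
  · rw [auxΦ_eq_cdf]; exact tendsto_cdf_atBot _
  · rw [auxΦ_eq_cdf]; exact tendsto_cdf_atTop _
  · exact fun _ _ => ENNReal.toReal_nonneg
  · exact fun _ _ => ENNReal.toReal_mono ENNReal.one_ne_top prob_le_one
  · intro k x y hxy
    refine ENNReal.toReal_mono (measure_ne_top _ _) (measure_mono fun ω hω => ?_)
    exact (lt_trans hω hxy).le
  · intro k x y hxy
    refine ENNReal.toReal_mono (measure_ne_top _ _) (measure_mono fun ω hω => ?_)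
    exact lt_of_le_of_lt hω hxy
  · intro x
    simp_rw [← auxΦ_Iio]
    exact hAN x

lemma aux_disint {Ω : Type*} [MeasurableSpace Ω] (P : Measure Ω) [IsProbabilityMeasure P]
    {E : Type*} [MeasurableSpace E] (N : Ω → ℕ) (hN : Measurable N) (X : Ω → E) (hX : Measurable X)
    (hind : IndepFun N X P) (A : ℕ → Set E) (hA : ∀ k, MeasurableSet (A k)) :
    (P {ω | X ω ∈ A (N ω)}).toReal = ∫ ω, (P {ω' | X ω' ∈ A (N ω)}).toReal ∂P := by
  have hAm : MeasurableSet {p : ℕ × E | p.2 ∈ A p.1} := by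
    have : {p : ℕ × E | p.2 ∈ A p.1} = ⋃ k, {k} ×ˢ A k := by
      ext ⟨k, e⟩
      simp
    rw [this]
    exact MeasurableSet.iUnion fun k => (measurableSet_singleton k).prod (hA k)
  have h1 := (indepFun_iff_map_prod_eq_prod_map_map hN.aemeasurable hX.aemeasurable).1 hind
  have h2 : P {ω | X ω ∈ A (N ω)} = (P.map (fun ω => (N ω, X ω))) {p : ℕ × E | p.2 ∈ A p.1} := by
    rw [Measure.map_apply (hN.prodMk hX) hAm]; rfl
  have : IsProbabilityMeasure (P.map X) := Measure.isProbabilityMeasure_map hX.aemeasurable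
  rw [h2, h1, Measure.prod_apply hAm, lintegral_map (measurable_of_countable _) hN, integral_toReal]
  · congr 1
    apply lintegral_congr
    intro ω
    have : Prod.mk (N ω) ⁻¹' {p : ℕ × E | p.2 ∈ A p.1} = A (N ω) := rfl
    rw [this, Measure.map_apply hX (hA _)]
    rfl
  · have : Measurable (fun k : ℕ => P {ω' | X ω' ∈ A k}) := measurable_of_countable _
    exact (this.comp hN).aemeasurable
  · exact Eventually.of_forall fun _ => measure_lt_top _ _

lemma aux_diff {Ω : Type*} [MeasurableSpace Ω] (P : Measure Ω) [IsProbabilityMeasure P]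
    (X : ℕ → Ω → ℝ) (hXm : ∀ i, Measurable (X i))
    (T : (n : ℕ) → (ℕ → ℝ) → ℝ) (hTm : ∀ n, Measurable (T n))
    (σ θ : ℝ)
    (hAN : ∀ x : ℝ,
      Filter.Tendsto
        (fun n : ℕ => (P {ω | σ * Real.sqrt (n : ℝ) * (T n (fun i => X i ω) - θ) < x}).toReal)
        Filter.atTop (nhds ((gaussianReal 0 1 (Set.Iio x)).toReal)))
    (N : ℕ → Ω → ℕ) (hNm : ∀ n, Measurable (N n)) (hNpos : ∀ n ω, 0 < N n ω)
    (hNindep : ∀ n, IndepFun (N n) (fun ω i => X i ω) P)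
    (hNinf : ∀ m : ℕ, Filter.Tendsto (fun n => P {ω | N n ω ≤ m}) Filter.atTop (nhds 0)) (x : ℝ) :
    Tendsto (fun n : ℕ => rvCDF P (fun ω => σ * Real.sqrt (n : ℝ) * (T (N n ω) (fun i => X i ω) - θ)) x
      - ∫ ω, auxΦ (x * √((N n ω : ℝ) / n)) ∂P) atTop (𝓝 0) := by
  set S : ℕ → Ω → ℝ := fun n ω => σ * Real.sqrt (n : ℝ) * (T n (fun i => X i ω) - θ) with hS
  have hunif := aux_uniform P S hAN
  have hXX : Measurable (fun ω i => X i ω) := measurable_pi_lambda _ hXm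
  have e1 : ∀ n : ℕ, 1 ≤ n → rvCDF P (fun ω => σ * Real.sqrt (n : ℝ) * (T (N n ω) (fun i => X i ω) - θ)) x
      = ∫ ω, rvCDF P (S (N n ω)) (x * √((N n ω : ℝ) / n)) ∂P := by
    intro n hn
    have h := aux_disint P (N n) (hNm n) (fun ω i => X i ω) hXX (hNindep n)
      (fun k => {f | σ * Real.sqrt (n : ℝ) * (T k f - θ) ≤ x})
      (fun k => measurableSet_le (by have := hTm k; fun_prop) measurable_const)
    refine h.trans ?_
    congr 1
    ext ω
    unfold rvCDF
    congr 2
    ext ω'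
    have hk : 0 < √(N n ω : ℝ) := Real.sqrt_pos.2 (by exact_mod_cast hNpos n ω)
    have hn' : 0 < √(n : ℝ) := Real.sqrt_pos.2 (by exact_mod_cast hn)
    simp only [mem_ofPred_eq, hS]
    rw [Real.sqrt_div (Nat.cast_nonneg _), ← mul_div_assoc, le_div_iff₀ hn',
      ← mul_le_mul_iff_of_pos_right hk]
    ring_nf
  have hmeas1 : ∀ n, Measurable fun ω => rvCDF P (S (N n ω)) (x * √((N n ω : ℝ) / n)) := by
    intro n
    have : Measurable (fun k : ℕ => rvCDF P (S k) (x * √((k : ℝ) / n))) := measurable_of_countable _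
    exact this.comp (hNm n)
  have hmeas2 : ∀ n, Measurable fun ω => auxΦ (x * √((N n ω : ℝ) / n)) := by
    intro n
    have : Measurable (fun k : ℕ => auxΦ (x * √((k : ℝ) / n))) := measurable_of_countable _
    exact this.comp (hNm n)
  have hb : ∀ k y, rvCDF P (S k) y ∈ Icc (0:ℝ) 1 := fun k y =>
    ⟨ENNReal.toReal_nonneg, ENNReal.toReal_mono ENNReal.one_ne_top prob_le_one⟩
  rw [Metric.tendsto_atTop]
  intro ε hε
  obtain ⟨K, hK⟩ := hunif (ε/3) (by positivity)
  have hN' : Tendsto (fun n => (P {ω | N n ω ≤ K}).toReal) atTop (𝓝 0) := by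
    have := (ENNReal.tendsto_toReal ENNReal.zero_ne_top).comp (hNinf K)
    rw [ENNReal.toReal_zero] at this
    exact this
  obtain ⟨n0, hn0⟩ := Metric.tendsto_atTop.1 hN' (ε/3) (by positivity)
  refine ⟨max n0 1, fun n hn => ?_⟩
  have hn1 : n0 ≤ n := le_trans (le_max_left _ _) hn
  have hn2 : 1 ≤ n := le_trans (le_max_right _ _) hn
  have hset : MeasurableSet {ω | N n ω ≤ K} := measurableSet_le (hNm n) measurable_const
  have i1 : Integrable (fun ω => rvCDF P (S (N n ω)) (x * √((N n ω : ℝ) / n))) P := by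
    refine Integrable.of_bound (C := 1) (hmeas1 n).aestronglyMeasurable (Eventually.of_forall fun ω => ?_)
    rw [Real.norm_eq_abs, abs_of_nonneg (hb _ _).1]
    exact (hb _ _).2
  have i2 : Integrable (fun ω => auxΦ (x * √((N n ω : ℝ) / n))) P := by
    refine Integrable.of_bound (C := 1) (hmeas2 n).aestronglyMeasurable (Eventually.of_forall fun ω => ?_)
    rw [Real.norm_eq_abs, abs_of_nonneg (auxΦ_nonneg _)]
    exact auxΦ_le_one _
  have i3 : Integrable (fun ω => ε/3 + {ω | N n ω ≤ K}.indicator (fun _ => (1:ℝ)) ω) P :=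
    (integrable_const _).add ((integrable_const _).indicator hset)
  rw [e1 n hn2, ← integral_sub i1 i2, Real.dist_eq, sub_zero]
  have hle := norm_integral_le_of_norm_le i3 (f := fun ω => rvCDF P (S (N n ω)) (x * √((N n ω : ℝ) / n)) - auxΦ (x * √((N n ω : ℝ) / n)))
    (Eventually.of_forall fun ω => by
      rw [Real.norm_eq_abs]
      by_cases hc : N n ω ≤ K
      · rw [indicator_of_mem (show ω ∈ {ω | N n ω ≤ K} from hc)]
        have a := hb (N n ω) (x * √((N n ω : ℝ) / n))
        have b := auxΦ_nonneg (x * √((N n ω : ℝ) / n))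
        have c := auxΦ_le_one (x * √((N n ω : ℝ) / n))
        rw [abs_le]
        constructor <;> linarith [a.1, a.2]
      · rw [indicator_of_notMem (show ω ∉ {ω | N n ω ≤ K} from hc), add_zero]
        exact hK _ (not_le.1 hc).le _)
  rw [integral_add (integrable_const _) ((integrable_const _).indicator hset),
    integral_indicator_const _ hset] at hle
  have h3 := hn0 n hn1
  rw [Real.dist_eq, sub_zero] at h3
  have h4 := le_abs_self (P {ω | N n ω ≤ K}).toReal
  have e5 : P.real {ω | N n ω ≤ K} = (P {ω | N n ω ≤ K}).toReal := rfl
  simp only [integral_const, probReal_univ, smul_eq_mul, mul_one, one_mul, e5, Real.norm_eq_abs] at hle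
  linarith

lemma aux_Mpos {Ω' : Type*} [MeasurableSpace Ω'] (P' : Measure Ω') [IsProbabilityMeasure P']
    (α : ℝ) (hα0 : 0 < α)
    (M : Ω' → ℝ) (hMm : Measurable M) (hMnn : ∀ᵐ ω ∂P', 0 ≤ M ω)
    (hM : ∀ s : ℝ, 0 ≤ s → ∫ ω, Real.exp (-(s * M ω)) ∂P' = (1 + s ^ (α / 2))⁻¹) :
    ∀ᵐ ω ∂P', 0 < M ω := by
  have hset : MeasurableSet {ω | M ω = 0} := hMm (measurableSet_singleton 0)
  have h1 : ∀ s : ℝ, 0 ≤ s → P'.real {ω | M ω = 0} ≤ (1 + s ^ (α / 2))⁻¹ := by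
    intro s hs
    rw [← hM s hs]
    have : P'.real {ω | M ω = 0} = ∫ ω, {ω | M ω = 0}.indicator (fun _ => (1:ℝ)) ω ∂P' := by
      rw [integral_indicator_const _ hset]; simp
    rw [this]
    refine integral_mono_ae ((integrable_const _).indicator hset) ?_ ?_
    · refine Integrable.of_bound (C := 1) (by fun_prop) ?_
      filter_upwards [hMnn] with ω hω
      rw [Real.norm_eq_abs, abs_of_pos (Real.exp_pos _), Real.exp_le_one_iff]
      exact neg_nonpos.2 (mul_nonneg hs hω)
    · refine Eventually.of_forall fun ω => ?_
      by_cases hc : M ω = 0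
      · rw [indicator_of_mem (show ω ∈ {ω | M ω = 0} from hc)]
        simp [hc]
      · rw [indicator_of_notMem (show ω ∉ {ω | M ω = 0} from hc)]
        exact (Real.exp_pos _).le
  have h2 : Tendsto (fun s : ℝ => (1 + s ^ (α / 2))⁻¹) atTop (𝓝 0) :=
    (tendsto_atTop_add_const_left _ _ (tendsto_rpow_atTop (by positivity))).inv_tendsto_atTop
  have h3 : P'.real {ω | M ω = 0} ≤ 0 := ge_of_tendsto h2 (by
    filter_upwards [eventually_ge_atTop 0] with s hs using h1 s hs)
  have h4 : P' {ω | M ω = 0} = 0 := by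
    have : P'.real {ω | M ω = 0} = 0 := le_antisymm h3 measureReal_nonneg
    rwa [measureReal_eq_zero_iff] at this
  have h5 := measure_eq_zero_iff_ae_notMem.1 h4
  filter_upwards [hMnn, h5] with ω h6 h7
  exact lt_of_le_of_ne h6 fun h => h7 h.symm

lemma aux_linnik (α : ℝ) (hα0 : 0 < α)
    (μL : Measure ℝ) [IsProbabilityMeasure μL]
    (hμL : ∀ t : ℝ, ∫ x, Complex.exp (Complex.I * ((t * x : ℝ) : ℂ)) ∂μL
      = (((1 + |t| ^ α)⁻¹ : ℝ) : ℂ))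
    {Ω' : Type*} [MeasurableSpace Ω'] (P' : Measure Ω') [IsProbabilityMeasure P']
    (M : Ω' → ℝ) (hMm : Measurable M) (hMpos : ∀ᵐ ω ∂P', 0 < M ω)
    (hM : ∀ s : ℝ, 0 ≤ s → ∫ ω, Real.exp (-(s * M ω)) ∂P' = (1 + s ^ (α / 2))⁻¹) (x : ℝ) :
    (μL (Iic x)).toReal = ∫ ω, auxΦ (x * √((2 * M ω)⁻¹)) ∂P' := by
  have hUm : Measurable fun ω => 2 * M ω := by fun_prop
  have hpos : ∀ᵐ ω ∂P', 0 < 2 * M ω := by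
    filter_upwards [hMpos] with ω hω
    positivity
  have := auxMix_prob P' _ hUm
  have heq : μL = auxMix P' (fun ω => 2 * M ω) := by
    apply Measure.ext_of_charFun
    ext t
    rw [auxMix_charFun P' _ hUm (by filter_upwards [hpos] with ω hω using hω.le), charFun_apply_real]
    have e1 : ∫ ω, Real.exp (-(t^2/2 * (2 * M ω))) ∂P' = (1 + |t| ^ α)⁻¹ := by
      have := hM (t^2) (by positivity)
      have e2 : (t^2) ^ (α/2) = |t| ^ α := by
        rw [← sq_abs, ← Real.rpow_natCast, ← Real.rpow_mul (abs_nonneg t)]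
        congr 1; push_cast; ring
      rw [e2] at this
      rw [← this]
      congr 1; ext ω; congr 1; ring
    rw [e1, ← hμL t]
    congr 1; ext y; congr 1; push_cast; ring
  rw [heq]
  exact auxMix_cdf P' _ hUm hpos x

/-- Let `α ∈ (0,2]` and let `T n` be statistics of `X 0, …, X (n-1)` which
are asymptotically normal: `P(σ·√n·(T_n − θ) < x) → Φ(x)`. Let `N n` be positive
integer-valued random variables independent of the observations, with `N n → ∞` in
probability. Then `σ·√n·(T_{N_n} − θ)` converges in distribution to the Linnik law with
parameter `α` if and only if `N_n/n` converges in distribution to `(2M)⁻¹`, where `M` is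
a Mittag-Leffler random variable with parameter `α/2`. -/
theorem randomSize_statistic_linnik_criterion
    {Ω : Type*} [MeasurableSpace Ω] (P : Measure Ω) [IsProbabilityMeasure P]
    (α : ℝ) (hα0 : 0 < α) (hα2 : α ≤ 2)
    (X : ℕ → Ω → ℝ) (hXm : ∀ i, Measurable (X i))
    (T : (n : ℕ) → (ℕ → ℝ) → ℝ)
    (hTm : ∀ n, Measurable (T n))
    (hTdep : ∀ n (f g : ℕ → ℝ), (∀ i < n, f i = g i) → T n f = T n g)
    (σ θ : ℝ) (hσ : 0 < σ)
    (hAN : ∀ x : ℝ,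
      Filter.Tendsto
        (fun n : ℕ => (P {ω | σ * Real.sqrt (n : ℝ) * (T n (fun i => X i ω) - θ) < x}).toReal)
        Filter.atTop (nhds ((gaussianReal 0 1 (Set.Iio x)).toReal)))
    (N : ℕ → Ω → ℕ) (hNm : ∀ n, Measurable (N n)) (hNpos : ∀ n ω, 0 < N n ω)
    (hNindep : ∀ n, IndepFun (N n) (fun ω i => X i ω) P)
    (hNinf : ∀ m : ℕ, Filter.Tendsto (fun n => P {ω | N n ω ≤ m}) Filter.atTop (nhds 0))
    (μL : Measure ℝ) [IsProbabilityMeasure μL]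
    (hμL : ∀ t : ℝ, ∫ x, Complex.exp (Complex.I * ((t * x : ℝ) : ℂ)) ∂μL
      = (((1 + |t| ^ α)⁻¹ : ℝ) : ℂ))
    {Ω' : Type*} [MeasurableSpace Ω'] (P' : Measure Ω') [IsProbabilityMeasure P']
    (M : Ω' → ℝ) (hMm : Measurable M) (hMnn : ∀ᵐ ω ∂P', 0 ≤ M ω)
    (hM : ∀ s : ℝ, 0 ≤ s → ∫ ω, Real.exp (-(s * M ω)) ∂P' = (1 + s ^ (α / 2))⁻¹) :
    ConvInDistrib P
        (fun n ω => σ * Real.sqrt (n : ℝ) * (T (N n ω) (fun i => X i ω) - θ))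
        (fun x => (μL (Set.Iic x)).toReal)
      ↔ ConvInDistrib P (fun n ω => (N n ω : ℝ) / n)
          (rvCDF P' (fun ω => (2 * M ω)⁻¹)) := by
  have hMpos := aux_Mpos P' α hα0 M hMm hMnn hM
  have hL := aux_linnik α hα0 μL hμL P' M hMm hMpos hM
  have hWm : Measurable fun ω => (2 * M ω)⁻¹ := by fun_prop
  have hcore := aux_core P P' (fun n ω => (N n ω : ℝ) / n)
    (fun n => by
      have : Measurable (fun k : ℕ => (k : ℝ) / n) := measurable_of_countable _
      exact this.comp (hNm n))
    (fun n ω => by positivity)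
    (fun n hn ω => by
      have h1 : (0:ℝ) < N n ω := by exact_mod_cast hNpos n ω
      have h2 : (0:ℝ) < n := by exact_mod_cast hn
      positivity)
    (fun ω => (2 * M ω)⁻¹) hWm (by
      filter_upwards [hMpos] with ω hω
      positivity)
  rw [← hcore]
  have hcont : Continuous (fun x => (μL (Iic x)).toReal) := by
    simp_rw [hL]
    refine continuous_of_dominated (bound := fun _ => 1) ?_ ?_ (integrable_const _) ?_
    · intro x
      exact (auxΦ_continuous.measurable.comp (by fun_prop : Measurable fun ω => x * √((2 * M ω)⁻¹))).aestronglyMeasurable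
    · intro x
      refine Eventually.of_forall fun ω => ?_
      rw [Real.norm_eq_abs, abs_of_nonneg (auxΦ_nonneg _)]
      exact auxΦ_le_one _
    · exact Eventually.of_forall fun ω => auxΦ_continuous.comp (by fun_prop)
  have hdiff := aux_diff P X hXm T hTm σ θ hAN N hNm hNpos hNindep hNinf
  constructor
  · intro h x
    have := (h x hcont.continuousAt).sub (hdiff x)
    simp only [sub_sub_cancel, sub_zero, hL] at this
    exact this
  · intro h x _
    have := (h x).add (hdiff x)
    simp only [add_sub_cancel, add_zero] at this
    simp only [hL]
    exact this
end
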